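/- arXiv:math/0611099 — 2 statements merged into one kernel-verified Lean document; each statement's English description precedes it below -/
import Mathlib

section
/- Let P = ∏_{i=1}^n (α_i, β_i) ⊂ ℝⁿ be an open n-rectangle containing the origin, let K > 0, and let (u_n) ⊂ 𝒞⋆^K(P) converge locally uniformly on P to u ∈ 𝒞⋆^K(P), with H_n an Alexandrov Hessian of u_n. Then there exist a subsequence (u_{n_k}) and a constant C > 0 such that for every ε > 0 there exist δ₀ > 0 and N₀ such that for all 0 < δ < δ₀ and all k > N₀, ∫_{P ∖ P_δ} log(det H_{n_k}(x)) dx < Cε. -/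
open MeasureTheory Filter Set Metric
open scoped ENNReal RealInnerProductSpace Topology NNReal

noncomputable section

namespace ToricExtremal

/-- The open polytope `{x | ⟨l i, x⟩ < λ i for all i}` determined by a half-space
presentation with normals `l` and constants `lam`. -/
def Poly {n : ℕ} {ι : Type*} [Fintype ι] (l : ι → EuclideanSpace ℝ (Fin n))
    (lam : ι → ℝ) : Set (EuclideanSpace ℝ (Fin n)) :=
  {x | ∀ i, ⟪l i, x⟫ < lam i}

/-- The inner polytope `P_δ`, whose facets are parallel to those of `P` at distance `δ`. -/
def PolyInner {n : ℕ} {ι : Type*} [Fintype ι] (l : ι → EuclideanSpace ℝ (Fin n))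
    (lam : ι → ℝ) (δ : ℝ) : Set (EuclideanSpace ℝ (Fin n)) :=
  {x | ∀ i, ⟪l i, x⟫ < lam i - ‖l i‖ * δ}

/-- The facet `F i = {x ∈ ∂P | ⟨l i, x⟩ = λ i}`. -/
def Facet {n : ℕ} {ι : Type*} [Fintype ι] (l : ι → EuclideanSpace ℝ (Fin n))
    (lam : ι → ℝ) (i : ι) : Set (EuclideanSpace ℝ (Fin n)) :=
  {x ∈ frontier (Poly l lam) | ⟪l i, x⟫ = lam i}

/-- `σ₀`: the `(n-1)`-dimensional Hausdorff measure on `ℝⁿ`. -/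
def sigma0 (n : ℕ) : Measure (EuclideanSpace ℝ (Fin n)) := μH[(n : ℝ) - 1]

/-- The weighted boundary measure `σ`, equal to `|l i|⁻¹ σ₀` on the facet `F i`. -/
def sigmaW {n : ℕ} {ι : Type*} [Fintype ι] (l : ι → EuclideanSpace ℝ (Fin n))
    (lam : ι → ℝ) : Measure (EuclideanSpace ℝ (Fin n)) :=
  ∑ i : ι, (ENNReal.ofReal (1 / ‖l i‖)) • ((sigma0 n).restrict (Facet l lam i))

/-- The Delzant condition: every normal `l i` is a primitive integral vector, and every
vertex (extreme point of the closure) lies on exactly `n` facets whose normals form a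
`ℤ`-basis of `ℤⁿ` (equivalently, an integral matrix of determinant `±1`). -/
def IsDelzant {n : ℕ} {ι : Type*} [Fintype ι] (l : ι → EuclideanSpace ℝ (Fin n))
    (lam : ι → ℝ) : Prop :=
  (∀ i j, ∃ m : ℤ, l i j = (m : ℝ)) ∧
  (∀ i, ∀ k : ℕ, 2 ≤ k → ¬ (∀ j, ∃ m : ℤ, l i j = (k : ℝ) * (m : ℝ))) ∧
  (∀ x ∈ Set.extremePoints ℝ (closure (Poly l lam)),
    ∃ e : Fin n ≃ {i : ι // ⟪l i, x⟫ = lam i},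
      |(Matrix.of fun j k => l (e j).1 k).det| = 1)

/-- The second partial derivative `∂²u/∂xᵢ∂xⱼ` at `x`. -/
def secondPartial {n : ℕ} (u : EuclideanSpace ℝ (Fin n) → ℝ) (i j : Fin n)
    (x : EuclideanSpace ℝ (Fin n)) : ℝ :=
  iteratedFDeriv ℝ 2 u x ![EuclideanSpace.single i 1, EuclideanSpace.single j 1]

/-- The (classical) Hessian matrix `D²u(x)`. -/
def hessianMatrix {n : ℕ} (u : EuclideanSpace ℝ (Fin n) → ℝ)
    (x : EuclideanSpace ℝ (Fin n)) : Matrix (Fin n) (Fin n) ℝ :=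
  Matrix.of fun i j => secondPartial u i j x

/-- Guillemin's canonical potential `u_P(x) = Σᵢ (λᵢ − ⟨lᵢ,x⟩) log (λᵢ − ⟨lᵢ,x⟩)`. -/
def guillemin {n : ℕ} {ι : Type*} [Fintype ι] (l : ι → EuclideanSpace ℝ (Fin n))
    (lam : ι → ℝ) (x : EuclideanSpace ℝ (Fin n)) : ℝ :=
  ∑ i : ι, (lam i - ⟪l i, x⟫) * Real.log (lam i - ⟪l i, x⟫)

/-- `(u_P)^{ij}_{ij}`: the double divergence `Σ_{i,j} ∂²((D²u_P)⁻¹)_{ij}/∂xᵢ∂xⱼ` of the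
inverse Hessian of the Guillemin potential. -/
def divDivInvHessGuillemin {n : ℕ} {ι : Type*} [Fintype ι]
    (l : ι → EuclideanSpace ℝ (Fin n)) (lam : ι → ℝ) (x : EuclideanSpace ℝ (Fin n)) : ℝ :=
  ∑ i : Fin n, ∑ j : Fin n,
    secondPartial (fun y => (hessianMatrix (guillemin l lam) y)⁻¹ i j) i j x

/-- `H` is an Alexandrov Hessian of `u` on `P`: a measurable matrix-valued map which is
a.e. positive semidefinite and gives the second-order Taylor expansion of `u` at a.e.
point of `P`. -/
def IsAlexHessian {n : ℕ} (P : Set (EuclideanSpace ℝ (Fin n)))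
    (u : EuclideanSpace ℝ (Fin n) → ℝ)
    (H : EuclideanSpace ℝ (Fin n) → Matrix (Fin n) (Fin n) ℝ) : Prop :=
  (∀ i j, Measurable fun x => H x i j) ∧
  ∀ᵐ x ∂(volume.restrict P),
    (H x).PosSemidef ∧
    ∃ g : EuclideanSpace ℝ (Fin n),
      Tendsto (fun y : EuclideanSpace ℝ (Fin n) =>
          (u y - u x - ⟪g, y - x⟫
            - (1 / 2) * ∑ i : Fin n, ∑ j : Fin n, H x i j * (y - x) i * (y - x) j)
          / ‖y - x‖ ^ 2)
        (𝓝[≠] x) (𝓝 0)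

/-- The radial boundary extension `u(z) = lim_{t→1⁻} u (t • z)` (as a value in `[0,∞]`,
computed via `limsup` so as to be everywhere defined). -/
def radExt {n : ℕ} (u : EuclideanSpace ℝ (Fin n) → ℝ) (z : EuclideanSpace ℝ (Fin n)) : ℝ≥0∞ :=
  Filter.limsup (fun t : ℝ => ENNReal.ofReal (u (t • z))) (𝓝[<] (1 : ℝ))

/-- The radial limits of `u` exist (in `[0,∞]`) at every boundary point of `P`. -/
def HasRadExt {n : ℕ} (P : Set (EuclideanSpace ℝ (Fin n)))
    (u : EuclideanSpace ℝ (Fin n) → ℝ) : Prop :=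
  ∀ z ∈ frontier P,
    Tendsto (fun t : ℝ => ENNReal.ofReal (u (t • z))) (𝓝[<] (1 : ℝ)) (𝓝 (radExt u z))

/-- The class `𝒞⋆^K(P)`: nonnegative convex functions on `P`, vanishing at the origin,
whose radial boundary extension has `σ₀`-integral at most `K`. -/
def MemCstar {n : ℕ} {ι : Type*} [Fintype ι] (l : ι → EuclideanSpace ℝ (Fin n))
    (lam : ι → ℝ) (K : ℝ) (u : EuclideanSpace ℝ (Fin n) → ℝ) : Prop :=
  ConvexOn ℝ (Poly l lam) u ∧ u 0 = 0 ∧ (∀ x ∈ Poly l lam, 0 ≤ u x) ∧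
  HasRadExt (Poly l lam) u ∧
  ∫⁻ z in frontier (Poly l lam), radExt u z ∂(sigma0 n) ≤ ENNReal.ofReal K

/-- The class `𝒞`: convex functions of the form `u = u_P + v` with `v` smooth up to the
boundary of `P`. -/
def MemC {n : ℕ} {ι : Type*} [Fintype ι] (l : ι → EuclideanSpace ℝ (Fin n))
    (lam : ι → ℝ) (u : EuclideanSpace ℝ (Fin n) → ℝ) : Prop :=
  ConvexOn ℝ (Poly l lam) u ∧
  ∃ v : EuclideanSpace ℝ (Fin n) → ℝ, ContDiffOn ℝ (⊤ : ℕ∞) v (closure (Poly l lam)) ∧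
    ∀ x ∈ closure (Poly l lam), u x = guillemin l lam x + v x

/-- The normalized class `𝒞̃ = {u ∈ 𝒞 : inf_P u = u 0 = 0}`. -/
def MemCt {n : ℕ} {ι : Type*} [Fintype ι] (l : ι → EuclideanSpace ℝ (Fin n))
    (lam : ι → ℝ) (u : EuclideanSpace ℝ (Fin n) → ℝ) : Prop :=
  MemC l lam u ∧ u 0 = 0 ∧ ∀ x ∈ Poly l lam, 0 ≤ u x

/-- `f` is an affine function on `ℝⁿ`. -/
def IsAffineFn {n : ℕ} (f : EuclideanSpace ℝ (Fin n) → ℝ) : Prop :=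
  ∃ (g : EuclideanSpace ℝ (Fin n)) (c : ℝ), ∀ x, f x = ⟪g, x⟫ + c

/-- The (signed) integral `∫_S log (det H) dx`, with values in `EReal`: it is defined as
the difference of the integrals of the positive part `log⁺` and the negative part `log⁻`. -/
def logDetE {n : ℕ} (S : Set (EuclideanSpace ℝ (Fin n)))
    (H : EuclideanSpace ℝ (Fin n) → Matrix (Fin n) (Fin n) ℝ) : EReal :=
  ((∫⁻ x in S, ENNReal.ofReal (Real.log (H x).det) : ℝ≥0∞) : EReal)
    - ((∫⁻ x in S, ENNReal.ofReal (-Real.log (H x).det) : ℝ≥0∞) : EReal)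

/-- The Donaldson functional
`ℱ(u) = −∫_P log (det H) dx + ∫_{∂P} u dσ − ∫_P f ⬝ u dx`, valued in `EReal`, where `H` is
an Alexandrov Hessian of `u` and the boundary term uses the radial extension of `u`. -/
def Fcal {n : ℕ} {ι : Type*} [Fintype ι] (l : ι → EuclideanSpace ℝ (Fin n)) (lam : ι → ℝ)
    (f : EuclideanSpace ℝ (Fin n) → ℝ) (u : EuclideanSpace ℝ (Fin n) → ℝ)
    (H : EuclideanSpace ℝ (Fin n) → Matrix (Fin n) (Fin n) ℝ) : EReal :=
  ((∫⁻ z, radExt u z ∂(sigmaW l lam) : ℝ≥0∞) : EReal)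
    - ((∫ x in Poly l lam, f x * u x : ℝ) : EReal)
    - logDetE (Poly l lam) H

/-- The half-space presentation of the open rectangle `∏ (αᵢ, βᵢ)`: normals. -/
def rectL (n : ℕ) : (Fin n ⊕ Fin n) → EuclideanSpace ℝ (Fin n) :=
  Sum.elim (fun i => EuclideanSpace.single i 1) (fun i => -EuclideanSpace.single i 1)

/-- The half-space presentation of the open rectangle `∏ (αᵢ, βᵢ)`: constants. -/
def rectLam {n : ℕ} (α β : Fin n → ℝ) : (Fin n ⊕ Fin n) → ℝ :=
  Sum.elim β (fun i => -α i)


/-- The functional `ℱ` on smooth elements of `𝒞̃` (real-valued):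
`ℱ(u) = −∫_P log det D²u + ∫_{∂P} u dσ − ∫_P f ⬝ u dx`. -/
def FcalSmooth {n : ℕ} {ι : Type*} [Fintype ι] (l : ι → EuclideanSpace ℝ (Fin n))
    (lam : ι → ℝ) (f u : EuclideanSpace ℝ (Fin n) → ℝ) : ℝ :=
  -(∫ x in Poly l lam, Real.log ((hessianMatrix u x).det))
    + ((∫ z, u z ∂(sigmaW l lam)) - ∫ x in Poly l lam, f x * u x)

lemma integral_weight_second_difference_le {f : ℝ → ℝ} {a b c d M r : ℝ}
    (hfc : ContinuousOn f (Ioo c d)) (hf0 : ∀ s ∈ Ioo c d, 0 ≤ f s)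
    (hr : 0 < r) (hrab : 2 * r ≤ b - a) (hca : c < a - r) (hbd : b + r < d)
    (hMa : ∀ s ∈ Icc (a - r) (a + r), f s ≤ M) (hMb : ∀ s ∈ Icc (b - r) (b + r), f s ≤ M) :
    ∫ s in a..b, (s - a) * (b - s) * (f (s + r) + f (s - r) - 2 * f s)
      ≤ 8 * (b - a) * M * r ^ 2 := by
  have hII : ∀ (g : ℝ → ℝ) (x y : ℝ), Continuous g → c < x → x ≤ y → y < d →
      IntervalIntegrable (fun s => g s * f s) volume x y := by
    intro g x y hg hx hxy hy
    refine ContinuousOn.intervalIntegrable ?_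
    rw [uIcc_of_le hxy]
    exact hg.continuousOn.mul (hfc.mono fun s hs => ⟨hx.trans_le hs.1, hs.2.trans_lt hy⟩)
  have hshift : ∀ e : ℝ, -r ≤ e → e ≤ r →
      IntervalIntegrable (fun s => (s - a) * (b - s) * f (s + e)) volume a b := by
    intro e he he'
    refine ContinuousOn.intervalIntegrable ?_
    rw [uIcc_of_le (by linarith)]
    refine ContinuousOn.mul (by fun_prop) (hfc.comp (by fun_prop) fun s hs => ?_)
    exact ⟨by linarith [hs.1], by linarith [hs.2]⟩
  have hplus := hshift r (by linarith) le_rfl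
  have hminus := hshift (-r) le_rfl (by linarith)
  have hzero := hII (fun s => (s - a) * (b - s)) a b (by fun_prop) (by linarith) (by linarith)
    (by linarith)
  have hsplit : ∫ s in a..b, (s - a) * (b - s) * (f (s + r) + f (s - r) - 2 * f s)
      = (∫ s in a..b, (s - a) * (b - s) * f (s + r))
        + (∫ s in a..b, (s - a) * (b - s) * f (s + -r))
        - 2 * ∫ s in a..b, (s - a) * (b - s) * f s := by
    rw [← intervalIntegral.integral_add hplus hminus, ← intervalIntegral.integral_const_mul,
      ← intervalIntegral.integral_sub (hplus.add hminus) (hzero.const_mul 2)]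
    refine intervalIntegral.integral_congr fun s _ => ?_
    simp only [sub_eq_add_neg]
    ring
  have hP : ∫ s in a..b, (s - a) * (b - s) * f (s + r)
      = ∫ s in (a + r)..(b + r), (s - r - a) * (b - (s - r)) * f s := by
    rw [← intervalIntegral.integral_comp_add_right]
    simp
  have hN : ∫ s in a..b, (s - a) * (b - s) * f (s + -r)
      = ∫ s in (a - r)..(b - r), (s + r - a) * (b - (s + r)) * f s := by
    rw [sub_eq_add_neg a r, sub_eq_add_neg b r,
      ← intervalIntegral.integral_comp_add_right
        (fun s => (s + r - a) * (b - (s + r)) * f s)]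
    simp
  have hP1 := hII (fun s => (s - r - a) * (b - (s - r))) (a + r) (b - r) (by fun_prop)
    (by linarith) (by linarith) (by linarith)
  have hP2 := hII (fun s => (s - r - a) * (b - (s - r))) (b - r) (b + r) (by fun_prop)
    (by linarith) (by linarith) (by linarith)
  have hN1 := hII (fun s => (s + r - a) * (b - (s + r))) (a + r) (b - r) (by fun_prop)
    (by linarith) (by linarith) (by linarith)
  have hN2 := hII (fun s => (s + r - a) * (b - (s + r))) (a - r) (a + r) (by fun_prop)
    (by linarith) (by linarith) (by linarith)
  have hZ1 := hII (fun s => (s - a) * (b - s)) (a + r) (b - r) (by fun_prop) (by linarith)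
    (by linarith) (by linarith)
  have hZ : ∫ s in (a + r)..(b - r), (s - a) * (b - s) * f s
      ≤ ∫ s in a..b, (s - a) * (b - s) * f s := by
    refine intervalIntegral.integral_mono_interval (by linarith) (by linarith) (by linarith)
      ?_ hzero
    filter_upwards [ae_restrict_mem measurableSet_Ioc] with s hs
    exact mul_nonneg (mul_nonneg (by linarith [hs.1]) (by linarith [hs.2]))
      (hf0 s ⟨by linarith [hs.1], by linarith [hs.2]⟩)
  have hmid : (∫ s in (a + r)..(b - r), (s - r - a) * (b - (s - r)) * f s)
      + (∫ s in (a + r)..(b - r), (s + r - a) * (b - (s + r)) * f s)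
      - 2 * (∫ s in (a + r)..(b - r), (s - a) * (b - s) * f s) ≤ 0 := by
    rw [← intervalIntegral.integral_add hP1 hN1, ← intervalIntegral.integral_const_mul,
      ← intervalIntegral.integral_sub (hP1.add hN1) (hZ1.const_mul 2)]
    rw [← neg_nonneg, ← intervalIntegral.integral_neg]
    refine intervalIntegral.integral_nonneg (by linarith) fun s hs => ?_
    have := hf0 s ⟨by linarith [hs.1], by linarith [hs.2]⟩
    nlinarith [mul_nonneg (sq_nonneg r) this]
  have hM0 : 0 ≤ M := (hf0 a ⟨by linarith, by linarith⟩).trans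
    (hMa a ⟨by linarith, by linarith⟩)
  have hend : ∀ (w : ℝ → ℝ) (x : ℝ), c < x - r → x + r < d → Continuous w →
      (∀ s ∈ Icc (x - r) (x + r), 0 ≤ w s ∧ w s ≤ (b - a) * (2 * r)) →
      (∀ s ∈ Icc (x - r) (x + r), f s ≤ M) →
      ∫ s in (x - r)..(x + r), w s * f s ≤ 4 * (b - a) * M * r ^ 2 := by
    intro w x hx hx' hw hwb hfM
    calc ∫ s in (x - r)..(x + r), w s * f s
        ≤ ∫ s in (x - r)..(x + r), (b - a) * (2 * r) * M := by
          refine intervalIntegral.integral_mono_on (by linarith)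
            (hII w _ _ hw hx (by linarith) hx') (by simp) fun s hs => ?_
          exact mul_le_mul (hwb s hs).2 (hfM s hs)
            (hf0 s ⟨by linarith [hs.1], by linarith [hs.2]⟩)
            ((hwb s hs).1.trans (hwb s hs).2)
      _ = 4 * (b - a) * M * r ^ 2 := by
          rw [intervalIntegral.integral_const, smul_eq_mul]; ring
  have hPe := hend (fun s => (s - r - a) * (b - (s - r))) b (by linarith) hbd (by fun_prop)
    (fun s hs => ⟨mul_nonneg (by linarith [hs.1]) (by linarith [hs.2]),
      mul_le_mul (by linarith [hs.2]) (by linarith [hs.1]) (by linarith [hs.2])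
        (by linarith)⟩) hMb
  have hNe := hend (fun s => (s + r - a) * (b - (s + r))) a hca (by linarith) (by fun_prop)
    (fun s hs => ⟨mul_nonneg (by linarith [hs.1]) (by linarith [hs.2]), by
      rw [mul_comm]
      exact mul_le_mul (by linarith [hs.1]) (by linarith [hs.2]) (by linarith [hs.1])
        (by linarith)⟩) hMa
  rw [hsplit, hP, hN, ← intervalIntegral.integral_add_adjacent_intervals hP1 hP2,
    ← intervalIntegral.integral_add_adjacent_intervals hN2 hN1]
  linarith

lemma lintegral_weight_mul_le {f h : ℝ → ℝ} {a b c d : ℝ} (hca : c < a) (hab : a < b)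
    (hbd : b < d) (hf : ConvexOn ℝ (Ioo c d) f) (hf0 : ∀ s ∈ Ioo c d, 0 ≤ f s)
    (hlim : ∀ᵐ s ∂(volume.restrict (Ioo a b)),
      Tendsto (fun r => (f (s + r) + f (s - r) - 2 * f s) / r ^ 2) (𝓝[>] 0) (𝓝 (h s))) :
    ∫⁻ s in Ioo a b, ENNReal.ofReal ((s - a) * (b - s) * h s)
      ≤ ENNReal.ofReal (8 * (b - a) * (f a + f b + 1)) := by
  have hfc : ContinuousOn f (Ioo c d) := hf.continuousOn isOpen_Ioo
  have hfa0 := hf0 a ⟨hca, hab.trans hbd⟩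
  have hfb0 := hf0 b ⟨hca.trans hab, hbd⟩
  have hnear : ∀ x ∈ Ioo c d, f x < f a + f b + 1 →
      ∃ ρ > 0, ∀ s, |s - x| ≤ ρ → f s ≤ f a + f b + 1 := by
    intro x hx hfx
    have := (hfc.continuousAt (isOpen_Ioo.mem_nhds hx)).eventually (gt_mem_nhds hfx)
    obtain ⟨ρ, hρ, H⟩ := Metric.eventually_nhds_iff.1 this
    refine ⟨ρ / 2, by positivity, fun s hs => (H ?_).le⟩
    rw [Real.dist_eq]; linarith
  obtain ⟨ρa, hρa, Ha⟩ := hnear a ⟨hca, hab.trans hbd⟩ (by linarith)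
  obtain ⟨ρb, hρb, Hb⟩ := hnear b ⟨hca.trans hab, hbd⟩ (by linarith)
  obtain ⟨ρ, hρ, hρ'⟩ : ∃ ρ > 0, ∀ r, 0 < r → r < ρ →
      r ≤ ρa ∧ r ≤ ρb ∧ 2 * r ≤ b - a ∧ c < a - r ∧ b + r < d := by
    refine ⟨min (min ρa ρb) (min ((b - a) / 2) (min (a - c) (d - b))), ?_, ?_⟩
    · have : 0 < (b - a) / 2 := by linarith
      have : 0 < a - c := by linarith
      have : 0 < d - b := by linarith
      positivity
    · intro r _ hr
      simp only [lt_min_iff] at hr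
      obtain ⟨⟨h1, h2⟩, h3, h4, h5⟩ := hr
      exact ⟨h1.le, h2.le, by linarith, by linarith, by linarith⟩
  let r : ℕ → ℝ := fun k => ρ / 2 / (k + 1)
  have hr0 : ∀ k, 0 < r k := fun k => by positivity
  have hrρ : ∀ k, r k < ρ := fun k => by
    have : r k ≤ ρ / 2 := div_le_self (by positivity) (by linarith [Nat.cast_nonneg (α := ℝ) k])
    linarith
  have hrlim : Tendsto r atTop (𝓝[>] 0) := by
    refine tendsto_nhdsWithin_iff.2 ⟨?_, Eventually.of_forall hr0⟩
    have := tendsto_one_div_add_atTop_nhds_zero_nat.const_mul (ρ / 2)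
    simpa [r, div_eq_mul_inv] using this
  let F : ℕ → ℝ → ℝ≥0∞ := fun k s =>
    ENNReal.ofReal ((s - a) * (b - s) * ((f (s + r k) + f (s - r k) - 2 * f s) / r k ^ 2))
  have hcont : ∀ k, ContinuousOn
      (fun s => (s - a) * (b - s) * (f (s + r k) + f (s - r k) - 2 * f s)) (Icc a b) := by
    intro k
    obtain ⟨-, -, -, h4, h5⟩ := hρ' (r k) (hr0 k) (hrρ k)
    have h0 := hr0 k
    refine ContinuousOn.mul (by fun_prop) ?_
    refine ((hfc.comp (by fun_prop) fun s hs => ?_).add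
      (hfc.comp (by fun_prop) fun s hs => ?_)).sub
      (continuousOn_const.mul (hfc.mono fun s hs => ?_))
    all_goals exact ⟨by linarith [hs.1], by linarith [hs.2]⟩
  have hlimF : ∫⁻ s in Ioo a b, ENNReal.ofReal ((s - a) * (b - s) * h s)
      = ∫⁻ s in Ioo a b, liminf (fun k => F k s) atTop := by
    refine lintegral_congr_ae ?_
    filter_upwards [hlim] with s hs
    refine (Tendsto.liminf_eq ?_).symm
    exact (ENNReal.continuous_ofReal.tendsto _).comp ((hs.comp hrlim).const_mul _)
  have hle : ∀ k, ∫⁻ s in Ioo a b, F k s ≤ ENNReal.ofReal (8 * (b - a) * (f a + f b + 1)) := by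
    intro k
    obtain ⟨h1, h2, h3, h4, h5⟩ := hρ' (r k) (hr0 k) (hrρ k)
    have h0 := hr0 k
    have hI := integral_weight_second_difference_le hfc hf0 h0 h3 h4 h5
      (fun s hs => Ha s (abs_le.2 ⟨by linarith [hs.1], by linarith [hs.2]⟩))
      (fun s hs => Hb s (abs_le.2 ⟨by linarith [hs.1], by linarith [hs.2]⟩))
    have hint := (((hcont k).integrableOn_Icc (μ := volume)).mono_set Ioo_subset_Icc_self).div_const (r k ^ 2)
    have hnn : ∀ᵐ s ∂(volume.restrict (Ioo a b)),
        0 ≤ (s - a) * (b - s) * (f (s + r k) + f (s - r k) - 2 * f s) / r k ^ 2 := by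
      filter_upwards [ae_restrict_mem measurableSet_Ioo] with s hs
      have hcx := hf.2 (show s + r k ∈ Ioo c d from ⟨by linarith [hs.1], by linarith [hs.2]⟩)
        (show s - r k ∈ Ioo c d from ⟨by linarith [hs.1], by linarith [hs.2]⟩)
        (show (0 : ℝ) ≤ 1 / 2 by norm_num) (show (0 : ℝ) ≤ 1 / 2 by norm_num) (by norm_num)
      simp only [smul_eq_mul] at hcx
      rw [show 1 / 2 * (s + r k) + 1 / 2 * (s - r k) = s by ring] at hcx
      exact div_nonneg (mul_nonneg (mul_nonneg (by linarith [hs.1]) (by linarith [hs.2]))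
        (by linarith)) (by positivity)
    have heq : ∫⁻ s in Ioo a b, F k s = ENNReal.ofReal
        (∫ s in Ioo a b, (s - a) * (b - s) * (f (s + r k) + f (s - r k) - 2 * f s) / r k ^ 2) := by
      rw [ofReal_integral_eq_lintegral_ofReal hint hnn]
      simp only [F, mul_div_assoc]
    rw [heq]
    refine ENNReal.ofReal_le_ofReal ?_
    rw [integral_div, ← integral_Ioc_eq_integral_Ioo,
      ← intervalIntegral.integral_of_le hab.le, div_le_iff₀ (by positivity)]
    exact hI
  rw [hlimF]
  refine (lintegral_liminf_le' fun k => ?_).trans ?_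
  · refine ENNReal.measurable_ofReal.comp_aemeasurable ?_
    have := ((((hcont k).mono Ioo_subset_Icc_self).aemeasurable (μ := volume)
      measurableSet_Ioo).div_const (r k ^ 2))
    simpa only [mul_div_assoc] using this
  · exact liminf_le_of_le (by isBoundedDefault) fun x hx => by
      obtain ⟨k, hk⟩ := hx.exists
      exact hk.trans (hle k)

lemma mem_poly_rect {n : ℕ} {a b : Fin n → ℝ} {x : EuclideanSpace ℝ (Fin n)} :
    x ∈ Poly (rectL n) (rectLam a b) ↔ ∀ i, x i ∈ Ioo (a i) (b i) := by
  simp only [Poly, rectL, rectLam, mem_ofPred_eq, Sum.forall, Sum.elim_inl, Sum.elim_inr,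
    inner_neg_left, neg_lt_neg_iff, EuclideanSpace.inner_single_left, map_one, one_mul, mem_Ioo]
  exact ⟨fun h i => ⟨h.2 i, h.1 i⟩, fun h => ⟨fun i => (h i).2, fun i => (h i).1⟩⟩

lemma isOpen_poly {n : ℕ} {ι : Type*} [Fintype ι] (l : ι → EuclideanSpace ℝ (Fin n))
    (lam : ι → ℝ) : IsOpen (Poly l lam) := by
  simp only [Poly, ofPred_forall]
  exact isOpen_iInter_of_finite fun i => isOpen_lt (by fun_prop) continuous_const

/-- The point of `ℝ^{m+1}` with `i`-th coordinate `s` and remaining coordinates `y`. -/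
def slicePt {m : ℕ} (i : Fin (m + 1)) (s : ℝ) (y : Fin m → ℝ) :
    EuclideanSpace ℝ (Fin (m + 1)) :=
  WithLp.toLp 2 (Fin.insertNth (α := fun _ => ℝ) i s y)

@[simp] lemma slicePt_same {m : ℕ} (i : Fin (m + 1)) (s : ℝ) (y : Fin m → ℝ) :
    slicePt i s y i = s := by
  simp [slicePt]

@[simp] lemma slicePt_succAbove {m : ℕ} (i : Fin (m + 1)) (s : ℝ) (y : Fin m → ℝ)
    (j : Fin m) : slicePt i s y (i.succAbove j) = y j := by
  simp [slicePt]

lemma slicePt_ext {m : ℕ} (i : Fin (m + 1)) {x x' : EuclideanSpace ℝ (Fin (m + 1))}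
    (h : x i = x' i) (h' : ∀ j, x (i.succAbove j) = x' (i.succAbove j)) : x = x' := by
  ext k
  exact (Fin.forall_iff_succAbove (P := fun k : Fin (m + 1) => x k = x' k) i).2 ⟨h, h'⟩ k

lemma slicePt_mem_poly_rect {m : ℕ} {a b : Fin (m + 1) → ℝ} {i : Fin (m + 1)} {s : ℝ}
    {y : Fin m → ℝ} :
    slicePt i s y ∈ Poly (rectL (m + 1)) (rectLam a b) ↔
      y ∈ univ.pi (fun j => Ioo (a (i.succAbove j)) (b (i.succAbove j))) ∧
        s ∈ Ioo (a i) (b i) := by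
  rw [mem_poly_rect, Fin.forall_iff_succAbove i]
  simp [and_comm]

lemma continuous_slicePt {m : ℕ} (i : Fin (m + 1)) :
    Continuous fun p : (Fin m → ℝ) × ℝ => slicePt i p.2 p.1 := by
  refine (PiLp.continuous_toLp 2 fun _ : Fin (m + 1) => ℝ).comp ?_
  exact Continuous.finInsertNth (A := fun _ : Fin (m + 1) => ℝ) i continuous_snd continuous_fst

lemma measurePreserving_slicePt {m : ℕ} (i : Fin (m + 1)) :
    MeasurePreserving (fun p : (Fin m → ℝ) × ℝ => slicePt i p.2 p.1) :=
  (PiLp.volume_preserving_toLp _).comp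
    (((volume_preserving_piFinSuccAbove (fun _ => ℝ) i).symm _).comp
      Measure.measurePreserving_swap)

lemma setLIntegral_rect_eq_slices {m : ℕ} (i : Fin (m + 1)) (a b : Fin (m + 1) → ℝ)
    {F : EuclideanSpace ℝ (Fin (m + 1)) → ℝ≥0∞} (hF : Measurable F) :
    ∫⁻ x in Poly (rectL (m + 1)) (rectLam a b), F x
      = ∫⁻ y in univ.pi (fun j => Ioo (a (i.succAbove j)) (b (i.succAbove j))),
          ∫⁻ s in Ioo (a i) (b i), F (slicePt i s y) := by
  have hP := (isOpen_poly (rectL (m + 1)) (rectLam a b)).measurableSet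
  have hQ : MeasurableSet (univ.pi fun j => Ioo (a (i.succAbove j)) (b (i.succAbove j))) :=
    MeasurableSet.univ_pi fun j => measurableSet_Ioo
  have hG : Measurable ((Poly (rectL (m + 1)) (rectLam a b)).indicator F) := hF.indicator hP
  rw [← lintegral_indicator hP, ← (measurePreserving_slicePt i).lintegral_comp hG,
    Measure.volume_eq_prod, lintegral_prod (fun p : (Fin m → ℝ) × ℝ =>
      (Poly (rectL (m + 1)) (rectLam a b)).indicator F (slicePt i p.2 p.1))
      (hG.comp (measurePreserving_slicePt i).measurable).aemeasurable, ← lintegral_indicator hQ]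
  refine lintegral_congr fun y => ?_
  by_cases hy : y ∈ univ.pi (fun j => Ioo (a (i.succAbove j)) (b (i.succAbove j)))
  · rw [indicator_of_mem hy, ← lintegral_indicator measurableSet_Ioo]
    refine lintegral_congr fun s => ?_
    by_cases hs : s ∈ Ioo (a i) (b i)
    · rw [indicator_of_mem hs, indicator_of_mem (slicePt_mem_poly_rect.2 ⟨hy, hs⟩)]
    · rw [indicator_of_notMem hs,
        indicator_of_notMem fun h => hs (slicePt_mem_poly_rect.1 h).2]
  · rw [indicator_of_notMem hy]
    exact (lintegral_congr fun s => indicator_of_notMem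
      (fun h => hy (slicePt_mem_poly_rect.1 h).1) F).trans lintegral_zero

lemma tendsto_second_difference {n : ℕ} {u : EuclideanSpace ℝ (Fin n) → ℝ}
    {x g : EuclideanSpace ℝ (Fin n)} {A : Matrix (Fin n) (Fin n) ℝ}
    (h : Tendsto (fun y : EuclideanSpace ℝ (Fin n) =>
          (u y - u x - ⟪g, y - x⟫
            - (1 / 2) * ∑ i : Fin n, ∑ j : Fin n, A i j * (y - x) i * (y - x) j)
          / ‖y - x‖ ^ 2) (𝓝[≠] x) (𝓝 0)) (i : Fin n) :
    Tendsto (fun r : ℝ => (u (x + r • EuclideanSpace.single i 1)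
      + u (x - r • EuclideanSpace.single i 1) - 2 * u x) / r ^ 2) (𝓝[>] 0) (𝓝 (A i i)) := by
  set e : EuclideanSpace ℝ (Fin n) := EuclideanSpace.single i 1 with he
  have he0 : e ≠ 0 := by simp [he]
  have hquad : ∀ r : ℝ, ∑ j, ∑ k, A j k * (r • e) j * (r • e) k = r ^ 2 * A i i := by
    intro r
    rw [Finset.sum_eq_single i, Finset.sum_eq_single i]
    · simp [he]; ring
    · intro k _ hk; simp [he, hk]
    · simp
    · intro j _ hj; simp [he, hj]
    · simp
  have hto : ∀ σ : ℝ, σ ≠ 0 → Tendsto (fun r : ℝ => x + (σ * r) • e) (𝓝[>] 0) (𝓝[≠] x) := by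
    intro σ hσ
    refine tendsto_nhdsWithin_iff.2 ⟨?_, ?_⟩
    · have : Continuous fun r : ℝ => x + (σ * r) • e := by fun_prop
      simpa using (this.tendsto 0).mono_left nhdsWithin_le_nhds
    · filter_upwards [self_mem_nhdsWithin] with r hr
      simp [he0, hσ, (mem_Ioi.1 hr).ne']
  have h1 := h.comp (hto 1 one_ne_zero)
  have h2 := h.comp (hto (-1) (by norm_num))
  have h3 := (h1.add h2).add_const (A i i)
  rw [add_zero, zero_add] at h3
  refine h3.congr' ?_
  filter_upwards [self_mem_nhdsWithin] with r hr
  have hr' : r ≠ 0 := (mem_Ioi.1 hr).ne'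
  have hn : ∀ σ : ℝ, ‖(σ * r) • e‖ ^ 2 = σ ^ 2 * r ^ 2 := by
    intro σ
    rw [norm_smul, he, PiLp.norm_single]
    simp [mul_pow]
  simp only [Function.comp_apply, add_sub_cancel_left, hquad, hn, inner_smul_right]
  have hm : x + (-1 * r) • e = x - r • e := by rw [neg_one_mul, neg_smul, sub_eq_add_neg]
  rw [hm, one_mul]
  field_simp
  ring

lemma lintegral_weight_hessian_le {m : ℕ} {α β a b : Fin (m + 1) → ℝ}
    {u : EuclideanSpace ℝ (Fin (m + 1)) → ℝ}
    {H : EuclideanSpace ℝ (Fin (m + 1)) → Matrix (Fin (m + 1)) (Fin (m + 1)) ℝ}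
    (hαa : ∀ i, α i < a i) (hab : ∀ i, a i < b i) (hbβ : ∀ i, b i < β i)
    (hu : ConvexOn ℝ (Poly (rectL (m + 1)) (rectLam α β)) u)
    (hu0 : ∀ x ∈ Poly (rectL (m + 1)) (rectLam α β), 0 ≤ u x)
    (hH : IsAlexHessian (Poly (rectL (m + 1)) (rectLam α β)) u H) (i : Fin (m + 1)) :
    ∫⁻ x in Poly (rectL (m + 1)) (rectLam a b),
        ENNReal.ofReal ((x i - a i) * (b i - x i) * H x i i)
      ≤ ∫⁻ y in univ.pi (fun j => Ioo (a (i.succAbove j)) (b (i.succAbove j))),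
          ENNReal.ofReal (8 * (b i - a i) * (u (slicePt i (a i) y) + u (slicePt i (b i) y) + 1)) := by
  have hHm := hH.1 i i
  rw [setLIntegral_rect_eq_slices i a b (by fun_prop)]
  have hae : ∀ᵐ y : Fin m → ℝ, ∀ᵐ s : ℝ,
      slicePt i s y ∈ Poly (rectL (m + 1)) (rectLam α β) →
        Tendsto (fun r : ℝ => (u (slicePt i s y + r • EuclideanSpace.single i 1)
          + u (slicePt i s y - r • EuclideanSpace.single i 1) - 2 * u (slicePt i s y)) / r ^ 2)
          (𝓝[>] 0) (𝓝 (H (slicePt i s y) i i)) := by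
    have h1 := (ae_restrict_iff' (isOpen_poly _ _).measurableSet).1 hH.2
    have h2 := (measurePreserving_slicePt i).quasiMeasurePreserving.ae h1
    rw [Measure.volume_eq_prod] at h2
    filter_upwards [Measure.ae_ae_of_ae_prod h2] with y hy
    filter_upwards [hy] with s hs hsP
    obtain ⟨-, g, hg⟩ := hs hsP
    exact tendsto_second_difference hg i
  have hQ : MeasurableSet (univ.pi fun j => Ioo (a (i.succAbove j)) (b (i.succAbove j))) :=
    MeasurableSet.univ_pi fun j => measurableSet_Ioo
  refine lintegral_mono_ae ?_
  filter_upwards [ae_restrict_mem hQ, ae_restrict_of_ae hae] with y hy hlim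
  have hyP : ∀ s ∈ Ioo (α i) (β i), slicePt i s y ∈ Poly (rectL (m + 1)) (rectLam α β) :=
    fun s hs => slicePt_mem_poly_rect.2 ⟨fun j hj =>
      ⟨(hαa _).trans (hy j hj).1, (hy j hj).2.trans (hbβ _)⟩, hs⟩
  have hcvx : ConvexOn ℝ (Ioo (α i) (β i)) fun s => u (slicePt i s y) := by
    refine ⟨convex_Ioo _ _, fun s hs s' hs' p q hp hq hpq => ?_⟩
    have heq : slicePt i (p • s + q • s') y = p • slicePt i s y + q • slicePt i s' y := by
      refine slicePt_ext i (by simp) fun j => ?_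
      simp [← add_mul, hpq]
    simp only [heq]
    exact hu.2 (hyP s hs) (hyP s' hs') hp hq hpq
  have hadd : ∀ s r : ℝ, slicePt i s y + r • EuclideanSpace.single i 1
      = slicePt i (s + r) y := fun s r => slicePt_ext i (by simp) (by simp)
  have hsub : ∀ s r : ℝ, slicePt i s y - r • EuclideanSpace.single i 1
      = slicePt i (s - r) y := fun s r => slicePt_ext i (by simp) (by simp)
  simp only [slicePt_same]
  refine lintegral_weight_mul_le (hαa i) (hab i) (hbβ i) hcvx (fun s hs => hu0 _ (hyP s hs)) ?_
  filter_upwards [ae_restrict_of_ae hlim, ae_restrict_mem measurableSet_Ioo] with s hs hsm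
  simpa only [hadd, hsub] using hs (hyP s ⟨(hαa i).trans hsm.1, hsm.2.trans (hbβ i)⟩)

lemma smul_mem_poly_rect {n : ℕ} {α β : Fin n → ℝ} (hα : ∀ i, α i < 0) (hβ : ∀ i, 0 < β i)
    {z : EuclideanSpace ℝ (Fin n)} (hz : ∀ i, z i ∈ Icc (α i) (β i)) {s : ℝ} (hs0 : 0 < s)
    (hs1 : s < 1) : s • z ∈ Poly (rectL n) (rectLam α β) := by
  refine mem_poly_rect.2 fun i => ?_
  have h1 := mul_le_mul_of_nonneg_left (hz i).1 hs0.le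
  have h2 := mul_le_mul_of_nonneg_left (hz i).2 hs0.le
  have h3 := mul_lt_mul_of_neg_right hs1 (hα i)
  have h4 := mul_lt_mul_of_pos_right hs1 (hβ i)
  simp only [PiLp.smul_apply, smul_eq_mul]
  exact ⟨by linarith, by linarith⟩

lemma mem_frontier_poly_rect {n : ℕ} {α β : Fin n → ℝ} (hα : ∀ i, α i < 0) (hβ : ∀ i, 0 < β i)
    {z : EuclideanSpace ℝ (Fin n)} (hz : ∀ i, z i ∈ Icc (α i) (β i)) {i : Fin n}
    (hi : z i ∉ Ioo (α i) (β i)) : z ∈ frontier (Poly (rectL n) (rectLam α β)) := by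
  rw [(isOpen_poly _ _).frontier_eq]
  refine ⟨?_, fun h => hi (mem_poly_rect.1 h i)⟩
  have hlim : Tendsto (fun s : ℝ => s • z) (𝓝[<] 1) (𝓝 z) := by
    have : Continuous fun s : ℝ => s • z := by fun_prop
    simpa using (this.tendsto 1).mono_left nhdsWithin_le_nhds
  refine mem_closure_of_tendsto hlim ?_
  filter_upwards [Ioo_mem_nhdsLT zero_lt_one] with s hs
  exact smul_mem_poly_rect hα hβ hz hs.1 hs.2

lemma ofReal_smul_le_radExt {n : ℕ} {α β : Fin n → ℝ} (hα : ∀ i, α i < 0)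
    (hβ : ∀ i, 0 < β i) {K : ℝ} {u : EuclideanSpace ℝ (Fin n) → ℝ}
    (hu : MemCstar (rectL n) (rectLam α β) K u) {z : EuclideanSpace ℝ (Fin n)}
    (hz : ∀ i, z i ∈ Icc (α i) (β i)) (hzf : z ∈ frontier (Poly (rectL n) (rectLam α β)))
    {t : ℝ} (ht0 : 0 < t) (ht1 : t < 1) : ENNReal.ofReal (u (t • z)) ≤ radExt u z := by
  obtain ⟨hcvx, hu0, hnn, hrad, -⟩ := hu
  refine ge_of_tendsto (hrad z hzf) ?_
  filter_upwards [Ioo_mem_nhdsLT ht1] with s hs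
  refine ENNReal.ofReal_le_ofReal ?_
  have hs0 : 0 < s := ht0.trans hs.1
  have hsz := smul_mem_poly_rect hα hβ hz hs0 hs.2
  have h0 : (0 : EuclideanSpace ℝ (Fin n)) ∈ Poly (rectL n) (rectLam α β) :=
    mem_poly_rect.2 fun i => ⟨hα i, hβ i⟩
  have hq : t / s ≤ 1 := (div_le_one hs0).2 hs.1.le
  have h := hcvx.2 hsz h0 (show 0 ≤ t / s by positivity) (show 0 ≤ 1 - t / s by linarith)
    (by ring)
  rw [smul_zero, add_zero, smul_smul, div_mul_cancel₀ _ hs0.ne', hu0, smul_zero, add_zero,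
    smul_eq_mul] at h
  exact h.trans (mul_le_of_le_one_left (hnn _ hsz) hq)

lemma lintegral_slice_le_boundary {m : ℕ} {α β : Fin (m + 1) → ℝ} (hα : ∀ i, α i < 0)
    (hβ : ∀ i, 0 < β i) {K : ℝ} {u : EuclideanSpace ℝ (Fin (m + 1)) → ℝ}
    (hu : MemCstar (rectL (m + 1)) (rectLam α β) K u) {t : ℝ} (ht0 : 0 < t) (ht1 : t < 1)
    (i : Fin (m + 1)) {c : ℝ} (hc : c = α i ∨ c = β i) :
    ∫⁻ y in univ.pi (fun j => Ioo (t * α (i.succAbove j)) (t * β (i.succAbove j))),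
      ENNReal.ofReal (u (slicePt i (t * c) y)) ≤ ENNReal.ofReal K := by
  set Q : Set (Fin m → ℝ) :=
    univ.pi (fun j => Ioo (t * α (i.succAbove j)) (t * β (i.succAbove j))) with hQdef
  have hQ : MeasurableSet Q := MeasurableSet.univ_pi fun j => measurableSet_Ioo
  set e : (Fin m → ℝ) → EuclideanSpace ℝ (Fin (m + 1)) := fun y => slicePt i c (t⁻¹ • y) with he
  let L : EuclideanSpace ℝ (Fin (m + 1)) → (Fin m → ℝ) := fun z j => t * z (i.succAbove j)
  have hLe : Function.LeftInverse L e := fun y => by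
    ext j
    simp [L, he, ht0.ne']
  have hec : Continuous e := (continuous_slicePt i).comp
    (f := fun y : Fin m → ℝ => (t⁻¹ • y, c)) (by fun_prop)
  have hLc : Continuous L := by fun_prop
  have hemb : MeasurableEmbedding e := (hLe.isClosedEmbedding hLc hec).measurableEmbedding
  have hLip : LipschitzWith 1 L := by
    refine LipschitzWith.of_dist_le_mul fun z z' => ?_
    rw [NNReal.coe_one, one_mul, dist_pi_le_iff dist_nonneg]
    intro j
    have h1 := PiLp.norm_apply_le (z - z') (i.succAbove j)
    rw [Real.dist_eq, ← mul_sub, abs_mul, abs_of_pos ht0, dist_eq_norm]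
    rw [PiLp.sub_apply, Real.norm_eq_abs] at h1
    nlinarith [abs_nonneg (z (i.succAbove j) - z' (i.succAbove j))]
  have heQ : ∀ y ∈ Q, (∀ k, e y k ∈ Icc (α k) (β k)) ∧
      e y ∈ frontier (Poly (rectL (m + 1)) (rectLam α β)) := by
    intro y hy
    have hcoord : ∀ k, e y k ∈ Icc (α k) (β k) := by
      rw [Fin.forall_iff_succAbove i]
      refine ⟨?_, fun j => ?_⟩
      · have := (hα i).trans (hβ i)
        rcases hc with rfl | rfl <;> simp [he, this.le]
      · have := hy j (mem_univ _)
        simp only [he, slicePt_succAbove, Pi.smul_apply, smul_eq_mul, mem_Icc,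
          le_inv_mul_iff₀ ht0, inv_mul_le_iff₀ ht0]
        exact ⟨this.1.le, this.2.le⟩
    refine ⟨hcoord, mem_frontier_poly_rect hα hβ hcoord (i := i) ?_⟩
    rcases hc with rfl | rfl <;> simp [he]
  have hte : ∀ y, slicePt i (t * c) y = t • e y := fun y =>
    slicePt_ext i (by simp [he]) (by simp [he, ht0.ne'])
  have hmeas : Measure.map e (volume.restrict Q)
      ≤ (sigma0 (m + 1)).restrict (frontier (Poly (rectL (m + 1)) (rectLam α β))) := by
    refine Measure.le_iff.2 fun A hA => ?_
    rw [Measure.map_apply hec.measurable hA, Measure.restrict_apply (hec.measurable hA),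
      Measure.restrict_apply hA]
    have hdim : ((m + 1 : ℕ) : ℝ) - 1 = (Fintype.card (Fin m) : ℝ) := by simp
    rw [sigma0, hdim, ← hausdorffMeasure_pi_real]
    calc μH[(Fintype.card (Fin m) : ℝ)] (e ⁻¹' A ∩ Q)
        ≤ μH[(Fintype.card (Fin m) : ℝ)]
            (L '' (A ∩ frontier (Poly (rectL (m + 1)) (rectLam α β)))) :=
          measure_mono fun y hy => ⟨e y, ⟨hy.1, (heQ y hy.2).2⟩, hLe y⟩
      _ ≤ _ := by
          simpa using hLip.hausdorffMeasure_image_le (Nat.cast_nonneg (Fintype.card (Fin m)))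
            (A ∩ frontier (Poly (rectL (m + 1)) (rectLam α β)))
  calc ∫⁻ y in Q, ENNReal.ofReal (u (slicePt i (t * c) y))
      ≤ ∫⁻ y in Q, radExt u (e y) := by
        refine setLIntegral_mono' hQ fun y hy => ?_
        rw [hte]
        exact ofReal_smul_le_radExt hα hβ hu (heQ y hy).1 (heQ y hy).2 ht0 ht1
    _ = ∫⁻ z, radExt u z ∂(Measure.map e (volume.restrict Q)) := (hemb.lintegral_map _).symm
    _ ≤ ∫⁻ z in frontier (Poly (rectL (m + 1)) (rectLam α β)), radExt u z ∂(sigma0 (m + 1)) :=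
        lintegral_mono' hmeas le_rfl
    _ ≤ ENNReal.ofReal K := hu.2.2.2.2

/-- A bound for the weighted integral of the diagonal Hessian entry `H i i` over the rectangle,
depending only on the rectangle and on the boundary mass `K`. -/
def hessianBound {m : ℕ} (α β : Fin (m + 1) → ℝ) (K : ℝ) (i : Fin (m + 1)) : ℝ≥0∞ :=
  ENNReal.ofReal (8 * (β i - α i)) * (ENNReal.ofReal K + ENNReal.ofReal K
    + volume (univ.pi fun j => Ioo (α (i.succAbove j)) (β (i.succAbove j))))

lemma volume_univ_pi_Ioo_ne_top {ι : Type*} [Fintype ι] (a b : ι → ℝ) :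
    volume (univ.pi fun j => Ioo (a j) (b j)) ≠ ∞ := by
  rw [Real.volume_pi_Ioo]
  exact (ENNReal.prod_lt_top fun _ _ => ENNReal.ofReal_lt_top).ne

lemma hessianBound_ne_top {m : ℕ} (α β : Fin (m + 1) → ℝ) (K : ℝ) (i : Fin (m + 1)) :
    hessianBound α β K i ≠ ∞ :=
  ENNReal.mul_ne_top ENNReal.ofReal_ne_top (ENNReal.add_ne_top.2
    ⟨by simp, volume_univ_pi_Ioo_ne_top _ _⟩)

lemma lintegral_weight_hessian_le_hessianBound {m : ℕ} {α β : Fin (m + 1) → ℝ}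
    (hα : ∀ i, α i < 0) (hβ : ∀ i, 0 < β i) {K : ℝ} {u : EuclideanSpace ℝ (Fin (m + 1)) → ℝ}
    {H : EuclideanSpace ℝ (Fin (m + 1)) → Matrix (Fin (m + 1)) (Fin (m + 1)) ℝ}
    (hu : MemCstar (rectL (m + 1)) (rectLam α β) K u)
    (hH : IsAlexHessian (Poly (rectL (m + 1)) (rectLam α β)) u H) (i : Fin (m + 1)) :
    ∫⁻ x in Poly (rectL (m + 1)) (rectLam α β),
      ENNReal.ofReal ((x i - α i) * (β i - x i) * H x i i) ≤ hessianBound α β K i := by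
  have hHm := hH.1 i i
  have hscaled : ∀ t ∈ Ioo (0 : ℝ) 1,
      ∫⁻ x in Poly (rectL (m + 1)) (rectLam (fun k => t * α k) fun k => t * β k),
        ENNReal.ofReal ((x i - t * α i) * (t * β i - x i) * H x i i) ≤ hessianBound α β K i := by
    intro t ht
    have htα : ∀ k, α k < t * α k := fun k => by nlinarith [hα k, ht.2]
    have htβ : ∀ k, t * β k < β k := fun k => by nlinarith [hβ k, ht.2]
    refine (lintegral_weight_hessian_le (a := fun k => t * α k) (b := fun k => t * β k) htα
      (fun k => mul_lt_mul_of_pos_left ((hα k).trans (hβ k)) ht.1) htβ hu.1 hu.2.2.1 hH i).trans ?_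
    set Q : Set (Fin m → ℝ) :=
      univ.pi (fun j => Ioo (t * α (i.succAbove j)) (t * β (i.succAbove j))) with hQdef
    have hQ : MeasurableSet Q := MeasurableSet.univ_pi fun j => measurableSet_Ioo
    have haem : ∀ c ∈ Ioo (α i) (β i),
        AEMeasurable (fun y => ENNReal.ofReal (u (slicePt i c y))) (volume.restrict Q) := by
      intro c hc
      refine ENNReal.measurable_ofReal.comp_aemeasurable (ContinuousOn.aemeasurable ?_ hQ)
      refine (hu.1.continuousOn (isOpen_poly _ _)).comp ?_ fun y hy => ?_
      · exact ((continuous_slicePt i).comp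
          (f := fun y : Fin m → ℝ => (y, c)) (by fun_prop)).continuousOn
      · exact slicePt_mem_poly_rect.2 ⟨fun j hj =>
          ⟨(htα _).trans (hy j hj).1, (hy j hj).2.trans (htβ _)⟩, hc⟩
    have hvol : volume Q ≤ volume (univ.pi fun j => Ioo (α (i.succAbove j)) (β (i.succAbove j))) :=
      measure_mono (pi_mono fun j _ => Ioo_subset_Ioo (htα _).le (htβ _).le)
    have hpt : ∀ y, ENNReal.ofReal (8 * (t * β i - t * α i)
          * (u (slicePt i (t * α i) y) + u (slicePt i (t * β i) y) + 1))
        ≤ ENNReal.ofReal (8 * (β i - α i)) * (ENNReal.ofReal (u (slicePt i (t * α i) y))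
          + ENNReal.ofReal (u (slicePt i (t * β i) y)) + 1) := by
      intro y
      rw [ENNReal.ofReal_mul (by nlinarith [hα i, hβ i, ht.1])]
      refine mul_le_mul' (ENNReal.ofReal_le_ofReal (by linarith [htα i, htβ i])) ?_
      refine ENNReal.ofReal_add_le.trans ?_
      rw [ENNReal.ofReal_one]
      gcongr
      exact ENNReal.ofReal_add_le
    have hA := haem (t * α i) ⟨htα i, by nlinarith [hα i, hβ i, ht.1]⟩
    have hB := haem (t * β i) ⟨by nlinarith [hα i, hβ i, ht.1], htβ i⟩
    refine (lintegral_mono hpt).trans ?_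
    rw [lintegral_const_mul' _ _ ENNReal.ofReal_ne_top, lintegral_add_right _ measurable_const,
      lintegral_add_left' hA, setLIntegral_const, one_mul, hessianBound]
    gcongr
    · exact lintegral_slice_le_boundary hα hβ hu ht.1 ht.2 i (Or.inl rfl)
    · exact lintegral_slice_le_boundary hα hβ hu ht.1 ht.2 i (Or.inr rfl)
  let F : ℝ → EuclideanSpace ℝ (Fin (m + 1)) → ℝ≥0∞ := fun t =>
    (Poly (rectL (m + 1)) (rectLam (fun k => t * α k) fun k => t * β k)).indicator fun x =>
      ENNReal.ofReal ((x i - t * α i) * (t * β i - x i) * H x i i)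
  have hPt : ∀ t : ℝ, MeasurableSet
      (Poly (rectL (m + 1)) (rectLam (fun k => t * α k) fun k => t * β k)) :=
    fun t => (isOpen_poly _ _).measurableSet
  have hlim : ∫⁻ x in Poly (rectL (m + 1)) (rectLam α β),
      ENNReal.ofReal ((x i - α i) * (β i - x i) * H x i i)
      = ∫⁻ x in Poly (rectL (m + 1)) (rectLam α β), liminf (fun t => F t x) (𝓝[<] 1) := by
    refine setLIntegral_congr_fun (isOpen_poly _ _).measurableSet fun x hx => ?_
    refine (Tendsto.liminf_eq ?_).symm
    have hev : ∀ᶠ t : ℝ in 𝓝[<] 1,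
        x ∈ Poly (rectL (m + 1)) (rectLam (fun k => t * α k) fun k => t * β k) := by
      simp only [mem_poly_rect] at hx ⊢
      refine nhdsWithin_le_nhds (eventually_all.2 fun k => ?_)
      refine Eventually.and ?_ ?_
      · have : Continuous fun t : ℝ => t * α k := by fun_prop
        exact this.continuousAt.eventually (gt_mem_nhds (by simpa using (hx k).1))
      · have : Continuous fun t : ℝ => t * β k := by fun_prop
        exact this.continuousAt.eventually (lt_mem_nhds (by simpa using (hx k).2))
    have hc : Continuous fun t : ℝ =>
        ENNReal.ofReal ((x i - t * α i) * (t * β i - x i) * H x i i) :=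
      ENNReal.continuous_ofReal.comp (by fun_prop)
    have := (hc.tendsto 1).mono_left (nhdsWithin_le_nhds (s := Iio 1))
    simp only [one_mul] at this
    refine this.congr' ?_
    filter_upwards [hev] with t ht
    simp only [F]
    rw [indicator_of_mem ht]
  rw [hlim]
  refine (lintegral_liminf_le' fun t => ?_).trans ?_
  · exact ((by fun_prop : Measurable fun x => ENNReal.ofReal
      ((x i - t * α i) * (t * β i - x i) * H x i i)).indicator (hPt t)).aemeasurable
  · refine liminf_le_of_le (by isBoundedDefault) fun b hb => ?_
    obtain ⟨t, hbt, ht⟩ := (hb.and (Ioo_mem_nhdsLT (zero_lt_one' ℝ))).exists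
    refine hbt.trans ((setLIntegral_le_lintegral _ _).trans ?_)
    rw [lintegral_indicator (hPt t)]
    exact hscaled t ht

lemma integrableOn_poly_rect_coord {m : ℕ} {a b : Fin (m + 1) → ℝ} (i : Fin (m + 1)) {φ : ℝ → ℝ}
    (hφm : Measurable φ) (hφ : IntegrableOn φ (Ioo (a i) (b i))) :
    IntegrableOn (fun x : EuclideanSpace ℝ (Fin (m + 1)) => φ (x i))
      (Poly (rectL (m + 1)) (rectLam a b)) := by
  refine ⟨(by fun_prop : Measurable fun x : EuclideanSpace ℝ (Fin (m + 1)) =>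
    φ (x i)).aestronglyMeasurable, ?_⟩
  rw [HasFiniteIntegral, setLIntegral_rect_eq_slices i a b (by fun_prop)]
  simp only [slicePt_same, setLIntegral_const]
  exact ENNReal.mul_lt_top hφ.2 (volume_univ_pi_Ioo_ne_top _ _).lt_top

lemma posLog_inv_le_abs_log (x : ℝ) : Real.posLog x⁻¹ ≤ |Real.log x| := by
  change max 0 (Real.log x⁻¹) ≤ |Real.log x|
  rw [Real.log_inv]
  exact max_le (abs_nonneg _) (neg_le_abs _)

lemma integrableOn_posLog_inv_sub_left (a b : ℝ) (hab : a ≤ b) :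
    IntegrableOn (fun s => Real.posLog (s - a)⁻¹) (Ioo a b) := by
  have h : IntervalIntegrable (fun s => Real.log (s - a)) volume a b := by
    have := (intervalIntegral.intervalIntegrable_log' (a := 0) (b := b - a)).comp_sub_right a
    simpa using this
  have h' := ((intervalIntegrable_iff_integrableOn_Ioo_of_le hab).1 h).abs
  refine h'.mono' ?_ (Eventually.of_forall fun s => ?_)
  · exact (Real.continuous_posLog.measurable.comp (by fun_prop)).aestronglyMeasurable
  · rw [Real.norm_of_nonneg Real.posLog_nonneg]
    exact posLog_inv_le_abs_log _

lemma integrableOn_posLog_inv_sub_right (a b : ℝ) (hab : a ≤ b) :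
    IntegrableOn (fun s => Real.posLog (b - s)⁻¹) (Ioo a b) := by
  have h : IntervalIntegrable (fun s => Real.log (b - s)) volume a b := by
    have := (intervalIntegral.intervalIntegrable_log' (a := b - a) (b := 0)).comp_sub_left b
    simpa using this
  have h' := ((intervalIntegrable_iff_integrableOn_Ioo_of_le hab).1 h).abs
  refine h'.mono' ?_ (Eventually.of_forall fun s => ?_)
  · exact (Real.continuous_posLog.measurable.comp (by fun_prop)).aestronglyMeasurable
  · rw [Real.norm_of_nonneg Real.posLog_nonneg]
    exact posLog_inv_le_abs_log _

lemma log_det_le_posLog_diag {n : ℕ} {A : Matrix (Fin n) (Fin n) ℝ} (hA : A.PosSemidef) :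
    Real.log A.det ≤ n * (Real.log n + ∑ i, Real.posLog (A i i)) := by
  have heig : ∀ i, hA.1.eigenvalues i ≤ ∑ i, A i i := by
    intro i
    have htr : ∑ i, A i i = ∑ i, hA.1.eigenvalues i := by
      simpa [Matrix.trace] using hA.1.trace_eq_sum_eigenvalues
    rw [htr]
    exact Finset.single_le_sum (fun j _ => hA.eigenvalues_nonneg j) (Finset.mem_univ i)
  calc Real.log A.det ≤ Real.posLog A.det := by
        rw [Real.posLog_def]; exact le_max_right _ _
    _ = Real.posLog (∏ i, hA.1.eigenvalues i) := by
        rw [hA.1.det_eq_prod_eigenvalues]; simp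
    _ ≤ ∑ i, Real.posLog (hA.1.eigenvalues i) := Real.posLog_prod _ _
    _ ≤ ∑ _i : Fin n, Real.posLog (∑ i, A i i) := Finset.sum_le_sum fun i _ =>
        Real.posLog_le_posLog (hA.eigenvalues_nonneg i) (heig i)
    _ = n * Real.posLog (∑ i, A i i) := by simp
    _ ≤ n * (Real.log n + ∑ i, Real.posLog (A i i)) := by
        gcongr
        simpa using Real.posLog_sum Finset.univ fun i => A i i

lemma posLog_le_weight_mul_add {x p q η : ℝ} (hx : 0 ≤ x) (hp : 0 < p) (hq : 0 < q)
    (hη : 0 < η) :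
    Real.posLog x ≤ η * (p * q * x)
      + (Real.posLog η⁻¹ + (Real.posLog p⁻¹ + Real.posLog q⁻¹)) := by
  have heq : x = (η * (p * q * x)) * (η⁻¹ * (p⁻¹ * q⁻¹)) := by
    field_simp
  have hlin : ∀ z : ℝ, 0 ≤ z → Real.posLog z ≤ z := fun z hz => by
    rw [Real.posLog_def]; exact max_le hz (Real.log_le_self hz)
  calc Real.posLog x = Real.posLog ((η * (p * q * x)) * (η⁻¹ * (p⁻¹ * q⁻¹))) := by rw [← heq]
    _ ≤ Real.posLog (η * (p * q * x)) + Real.posLog (η⁻¹ * (p⁻¹ * q⁻¹)) := Real.posLog_mul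
    _ ≤ η * (p * q * x) + (Real.posLog η⁻¹ + Real.posLog (p⁻¹ * q⁻¹)) :=
        add_le_add (hlin _ (by positivity)) Real.posLog_mul
    _ ≤ _ := by
        gcongr
        exact Real.posLog_mul

/-- A bound for `log det H` off its weighted Hessian part; see `log_det_le_logDetMajorant`. -/
def logDetMajorant {n : ℕ} (α β : Fin n → ℝ) (η : ℝ) (x : EuclideanSpace ℝ (Fin n)) : ℝ :=
  n * (Real.log n + ∑ i, (Real.posLog η⁻¹
    + (Real.posLog (x i - α i)⁻¹ + Real.posLog (β i - x i)⁻¹)))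

lemma log_det_le_logDetMajorant {n : ℕ} {α β : Fin n → ℝ} {x : EuclideanSpace ℝ (Fin n)}
    (hx : x ∈ Poly (rectL n) (rectLam α β)) {A : Matrix (Fin n) (Fin n) ℝ} (hA : A.PosSemidef)
    {η : ℝ} (hη : 0 < η) :
    Real.log A.det ≤ ∑ i, n * η * ((x i - α i) * (β i - x i) * A i i)
      + logDetMajorant α β η x := by
  have hx := mem_poly_rect.1 hx
  calc Real.log A.det ≤ n * (Real.log n + ∑ i, Real.posLog (A i i)) := log_det_le_posLog_diag hA
    _ ≤ n * (Real.log n + ∑ i, (η * ((x i - α i) * (β i - x i) * A i i) + (Real.posLog η⁻¹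
          + (Real.posLog (x i - α i)⁻¹ + Real.posLog (β i - x i)⁻¹)))) := by
        gcongr with i
        exact posLog_le_weight_mul_add hA.diag_nonneg (sub_pos.2 (hx i).1) (sub_pos.2 (hx i).2) hη
    _ = _ := by
        rw [logDetMajorant, Finset.sum_add_distrib, ← add_assoc, mul_add, mul_add, mul_add,
          Finset.mul_sum]
        simp only [mul_assoc]
        ring

lemma integrableOn_logDetMajorant {m : ℕ} {α β : Fin (m + 1) → ℝ} (hαβ : ∀ i, α i ≤ β i)
    (η : ℝ) :
    IntegrableOn (logDetMajorant α β η) (Poly (rectL (m + 1)) (rectLam α β)) := by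
  have hconst : ∀ c : ℝ, IntegrableOn (fun _ : EuclideanSpace ℝ (Fin (m + 1)) => c)
      (Poly (rectL (m + 1)) (rectLam α β)) := fun c =>
    integrableOn_poly_rect_coord 0 (φ := fun _ => c) measurable_const (by simp)
  refine ((hconst _).add (integrable_finsetSum _ fun i _ => (hconst _).add (Integrable.add ?_ ?_))).const_mul _
  · exact integrableOn_poly_rect_coord i (φ := fun s => Real.posLog (s - α i)⁻¹)
      (Real.continuous_posLog.measurable.comp (by fun_prop)) (integrableOn_posLog_inv_sub_left _ _ (hαβ i))
  · exact integrableOn_poly_rect_coord i (φ := fun s => Real.posLog (β i - s)⁻¹)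
      (Real.continuous_posLog.measurable.comp (by fun_prop)) (integrableOn_posLog_inv_sub_right _ _ (hαβ i))

lemma isOpen_polyInner {n : ℕ} {ι : Type*} [Fintype ι] (l : ι → EuclideanSpace ℝ (Fin n))
    (lam : ι → ℝ) (δ : ℝ) : IsOpen (PolyInner l lam δ) :=
  isOpen_poly l fun i => lam i - ‖l i‖ * δ

lemma iInter_poly_diff_polyInner {n : ℕ} {ι : Type*} [Fintype ι]
    (l : ι → EuclideanSpace ℝ (Fin n)) (lam : ι → ℝ) :
    ⋂ δ > (0 : ℝ), Poly l lam \ PolyInner l lam δ = ∅ := by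
  refine eq_empty_of_forall_notMem fun x hx => ?_
  simp only [mem_iInter] at hx
  have hxP : x ∈ Poly l lam := (hx 1 one_pos).1
  have hev : ∀ᶠ δ : ℝ in 𝓝[>] 0, x ∈ PolyInner l lam δ := by
    refine nhdsWithin_le_nhds (eventually_all.2 fun i => ?_)
    have : Continuous fun δ : ℝ => lam i - ‖l i‖ * δ := by fun_prop
    exact this.continuousAt.eventually (lt_mem_nhds (by simpa using hxP i))
  obtain ⟨δ, hδ, hδ0⟩ := (hev.and self_mem_nhdsWithin).exists
  exact (hx δ hδ0).2 hδ

lemma tendsto_lintegral_poly_diff_polyInner {n : ℕ} {ι : Type*} [Fintype ι]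
    (l : ι → EuclideanSpace ℝ (Fin n)) (lam : ι → ℝ) {G : EuclideanSpace ℝ (Fin n) → ℝ≥0∞}
    (hG : ∫⁻ x in Poly l lam, G x ≠ ∞) :
    Tendsto (fun δ => ∫⁻ x in Poly l lam \ PolyInner l lam δ, G x) (𝓝[>] 0) (𝓝 0) := by
  have hS : ∀ δ, MeasurableSet (Poly l lam \ PolyInner l lam δ) := fun δ =>
    (isOpen_poly l lam).measurableSet.diff (isOpen_polyInner l lam δ).measurableSet
  have h := tendsto_measure_biInter_gt (μ := volume.withDensity G) (a := (0 : ℝ))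
    (s := fun δ => Poly l lam \ PolyInner l lam δ) (fun δ _ => (hS δ).nullMeasurableSet)
    (fun δ δ' _ hδ => sdiff_subset_sdiff_right fun x hx i => (hx i).trans_le (by gcongr))
    ⟨1, one_pos, by
      rw [withDensity_apply _ (hS 1)]
      exact ne_top_of_le_ne_top hG (lintegral_mono_set sdiff_subset)⟩
  rw [iInter_poly_diff_polyInner, measure_empty] at h
  refine h.congr fun δ => ?_
  exact withDensity_apply _ (hS δ)

/-- The boundary strips carry uniformly small `∫ log⁺ det H` over the class `𝒞⋆^K(P)` of a
rectangle `P`. -/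
lemma exists_lintegral_log_det_strip_lt {m : ℕ} {α β : Fin (m + 1) → ℝ} (hα : ∀ i, α i < 0)
    (hβ : ∀ i, 0 < β i) (K : ℝ) {ε : ℝ} (hε : 0 < ε) :
    ∃ δ₀ > 0, ∀ δ, 0 < δ → δ < δ₀ →
      ∀ (u : EuclideanSpace ℝ (Fin (m + 1)) → ℝ)
        (H : EuclideanSpace ℝ (Fin (m + 1)) → Matrix (Fin (m + 1)) (Fin (m + 1)) ℝ),
        MemCstar (rectL (m + 1)) (rectLam α β) K u →
        IsAlexHessian (Poly (rectL (m + 1)) (rectLam α β)) u H →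
        ∫⁻ x in Poly (rectL (m + 1)) (rectLam α β) \ PolyInner (rectL (m + 1)) (rectLam α β) δ,
          ENNReal.ofReal (Real.log (H x).det) < ENNReal.ofReal ε := by
  set D : ℝ := (∑ i, hessianBound α β K i).toReal with hD
  have hD0 : 0 ≤ D := ENNReal.toReal_nonneg
  have hDtop : ∑ i, hessianBound α β K i ≠ ∞ :=
    ENNReal.sum_ne_top.2 fun i _ => hessianBound_ne_top α β K i
  have hn : (0 : ℝ) < (m + 1 : ℕ) := by positivity
  set η : ℝ := ε / (2 * ((m + 1 : ℕ) * (D + 1))) with hηdef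
  have hη : 0 < η := by positivity
  have hηD : (m + 1 : ℕ) * η * D ≤ ε / 2 := by
    have : (m + 1 : ℕ) * η * (D + 1) = ε / 2 := by rw [hηdef]; field_simp
    nlinarith [mul_pos hn hη]
  have hGint := integrableOn_logDetMajorant (fun i => ((hα i).trans (hβ i)).le) η
  have hlim := tendsto_lintegral_poly_diff_polyInner (rectL (m + 1)) (rectLam α β)
    (G := fun x => ENNReal.ofReal (logDetMajorant α β η x)) hGint.lintegral_lt_top.ne
  have hsmall := hlim.eventually (gt_mem_nhds (ENNReal.ofReal_pos.2 (half_pos hε)))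
  obtain ⟨δ₀, hδ₀, hsub⟩ := mem_nhdsGT_iff_exists_Ioo_subset.1 hsmall
  refine ⟨δ₀, hδ₀, fun δ hδ hδδ₀ u H hu hH => ?_⟩
  have hGδ := hsub ⟨hδ, hδδ₀⟩
  simp only [mem_ofPred_eq] at hGδ
  set P := Poly (rectL (m + 1)) (rectLam α β) with hP
  set S := P \ PolyInner (rectL (m + 1)) (rectLam α β) δ with hS
  have hPm : MeasurableSet P := (isOpen_poly _ _).measurableSet
  have hSm : MeasurableSet S := hPm.diff (isOpen_polyInner _ _ δ).measurableSet
  have hHm := hH.1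
  have hWm : ∀ i, Measurable fun x : EuclideanSpace ℝ (Fin (m + 1)) =>
      ENNReal.ofReal ((x i - α i) * (β i - x i) * H x i i) := fun i => by
    have := hHm i i
    fun_prop
  have hpt : ∀ᵐ x ∂(volume.restrict S), ENNReal.ofReal (Real.log (H x).det)
      ≤ ∑ i, ENNReal.ofReal ((m + 1 : ℕ) * η)
            * ENNReal.ofReal ((x i - α i) * (β i - x i) * H x i i)
          + ENNReal.ofReal (logDetMajorant α β η x) := by
    filter_upwards [ae_restrict_of_ae_restrict_of_subset sdiff_subset hH.2,
      ae_restrict_mem hSm] with x hxH hxS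
    refine (ENNReal.ofReal_le_ofReal (log_det_le_logDetMajorant hxS.1 hxH.1 hη)).trans ?_
    refine ENNReal.ofReal_add_le.trans ?_
    have hx := mem_poly_rect.1 hxS.1
    rw [ENNReal.ofReal_sum_of_nonneg fun i _ => mul_nonneg (by positivity)
      (mul_nonneg (mul_nonneg (sub_pos.2 (hx i).1).le (sub_pos.2 (hx i).2).le)
        hxH.1.diag_nonneg)]
    simp only [ENNReal.ofReal_mul (mul_pos hn hη).le, le_refl]
  calc ∫⁻ x in S, ENNReal.ofReal (Real.log (H x).det)
      ≤ ∫⁻ x in S, (∑ i, ENNReal.ofReal ((m + 1 : ℕ) * η)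
            * ENNReal.ofReal ((x i - α i) * (β i - x i) * H x i i)
          + ENNReal.ofReal (logDetMajorant α β η x)) := lintegral_mono_ae hpt
    _ = (∑ i, ENNReal.ofReal ((m + 1 : ℕ) * η)
            * ∫⁻ x in S, ENNReal.ofReal ((x i - α i) * (β i - x i) * H x i i))
          + ∫⁻ x in S, ENNReal.ofReal (logDetMajorant α β η x) := by
        rw [lintegral_add_left (Finset.measurable_fun_sum _ fun i _ => (hWm i).const_mul _),
          lintegral_finsetSum _ fun i _ => (hWm i).const_mul _]
        simp only [lintegral_const_mul _ (hWm _)]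
    _ ≤ ENNReal.ofReal ((m + 1 : ℕ) * η) * ∑ i, hessianBound α β K i
          + ∫⁻ x in S, ENNReal.ofReal (logDetMajorant α β η x) := by
        rw [Finset.mul_sum]
        gcongr with i
        exact (lintegral_mono_set sdiff_subset).trans
          (lintegral_weight_hessian_le_hessianBound hα hβ hu hH i)
    _ ≤ ENNReal.ofReal (ε / 2) + ∫⁻ x in S, ENNReal.ofReal (logDetMajorant α β η x) := by
        gcongr
        rw [← ENNReal.ofReal_toReal hDtop, ← hD, ← ENNReal.ofReal_mul (by positivity)]
        exact ENNReal.ofReal_le_ofReal hηD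
    _ < ENNReal.ofReal (ε / 2) + ENNReal.ofReal (ε / 2) := by
        exact ENNReal.add_lt_add_left ENNReal.ofReal_ne_top hGδ
    _ = ENNReal.ofReal ε := by
        rw [← ENNReal.ofReal_add (by positivity) (by positivity), add_halves]

/-- Lemma 3.2: boundary-strip smallness of `∫ log det` for a locally
uniformly convergent sequence in `𝒞⋆^K(P)`, `P` an `n`-rectangle. -/
theorem logdet_boundary_strip_small_rectangle
    (n : ℕ) (hn : 1 ≤ n) (α β : Fin n → ℝ) (hα : ∀ i, α i < 0) (hβ : ∀ i, 0 < β i)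
    (K : ℝ) (hK : 0 < K)
    (useq : ℕ → EuclideanSpace ℝ (Fin n) → ℝ) (u : EuclideanSpace ℝ (Fin n) → ℝ)
    (Hseq : ℕ → EuclideanSpace ℝ (Fin n) → Matrix (Fin n) (Fin n) ℝ)
    (hmem : ∀ m, MemCstar (rectL n) (rectLam α β) K (useq m))
    (hu : MemCstar (rectL n) (rectLam α β) K u)
    (hconv : TendstoLocallyUniformlyOn useq u atTop (Poly (rectL n) (rectLam α β)))
    (hHseq : ∀ m, IsAlexHessian (Poly (rectL n) (rectLam α β)) (useq m) (Hseq m)) :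
    ∃ φ : ℕ → ℕ, StrictMono φ ∧ ∃ C : ℝ, 0 < C ∧
      ∀ ε : ℝ, 0 < ε → ∃ δ₀ : ℝ, 0 < δ₀ ∧ ∃ N₀ : ℕ,
        ∀ δ : ℝ, 0 < δ → δ < δ₀ → ∀ k : ℕ, N₀ < k →
          logDetE (Poly (rectL n) (rectLam α β) \ PolyInner (rectL n) (rectLam α β) δ)
              (Hseq (φ k)) < ((C * ε : ℝ) : EReal) := by
  obtain ⟨m, rfl⟩ : ∃ m, n = m + 1 := ⟨n - 1, by omega⟩
  refine ⟨id, strictMono_id, 1, one_pos, fun ε hε => ?_⟩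
  obtain ⟨δ₀, hδ₀, h⟩ := exists_lintegral_log_det_strip_lt hα hβ K hε
  refine ⟨δ₀, hδ₀, 0, fun δ hδ hδδ₀ k _ => ?_⟩
  have hlt := h δ hδ hδδ₀ (useq k) (Hseq k) (hmem k) (hHseq k)
  rw [one_mul, logDetE]
  refine (EReal.sub_le_sub le_rfl (EReal.coe_ennreal_nonneg _)).trans_lt ?_
  rw [sub_zero]
  refine (EReal.coe_ennreal_lt_coe_ennreal_iff.2 hlt).trans_eq ?_
  rw [EReal.coe_ennreal_ofReal, max_eq_left hε.le]

end ToricExtremal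
end
end

section
/- Let U ⊂ ℝⁿ be a bounded open convex set, let u be a convex function on U with Alexandrov Hessian H, let δ > 0, and let Ω ⊂ U be a measurable set with dist(Ω, ∂U) ≥ δ. Then ∫_Ω det(H(x)) dx ≤ ω_n ((sup_U u − inf_U u)/δ)^n, where ω_n is the volume of the unit ball in ℝⁿ. -/
open MeasureTheory Filter Set Metric
open scoped ENNReal RealInnerProductSpace Topology NNReal

noncomputable section

namespace ToricExtremal

section Taylor

variable {E : Type*} [NormedAddCommGroup E] [InnerProductSpace ℝ E]

/-- `u` has a second-order Taylor expansion at `x` with gradient `g` and Hessian `L`. -/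
def HasTaylorTwo (u : E → ℝ) (x g : E) (L : E →L[ℝ] E) : Prop :=
  (fun v : E => u (x + v) - u x - ⟪g, v⟫ - 1 / 2 * ⟪L v, v⟫) =o[𝓝 0] fun v : E => ‖v‖ ^ 2

/-- `p` is a subgradient of `u` on `U` at `x`. -/
def IsSubgradient (u : E → ℝ) (U : Set E) (x p : E) : Prop :=
  ∀ z ∈ U, u x + ⟪p, z - x⟫ ≤ u z

variable {u : E → ℝ} {U : Set E} {x y g p : E} {L : E →L[ℝ] E}

lemma HasTaylorTwo.eventually_abs_le (h : HasTaylorTwo u x g L) {ε : ℝ} (hε : 0 < ε) :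
    ∀ᶠ v in 𝓝 (0 : E),
      |u (x + v) - u x - ⟪g, v⟫ - 1 / 2 * ⟪L v, v⟫| ≤ ε * ‖v‖ ^ 2 := by
  filter_upwards [h.def hε] with v hv
  simpa using hv

lemma HasTaylorTwo.eventually_abs_le_line (h : HasTaylorTwo u x g L) {ε : ℝ} (hε : 0 < ε)
    (v : E) : ∀ᶠ t in 𝓝[>] (0 : ℝ), 0 < t ∧ t < 1 ∧
      |u (x + t • v) - u x - t * ⟪g, v⟫ - t ^ 2 * (1 / 2 * ⟪L v, v⟫)| ≤ ε * t ^ 2 * ‖v‖ ^ 2 := by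
  have hlim : Tendsto (fun t : ℝ => t • v) (𝓝[>] 0) (𝓝 0) := by
    have : Continuous fun t : ℝ => t • v := by fun_prop
    simpa using (this.tendsto 0).mono_left nhdsWithin_le_nhds
  filter_upwards [hlim.eventually (h.eventually_abs_le hε), self_mem_nhdsWithin,
    nhdsWithin_le_nhds (eventually_lt_nhds (zero_lt_one' ℝ))] with t ht ht0 ht1
  refine ⟨ht0, ht1, ?_⟩
  simp only [map_smul, inner_smul_left, inner_smul_right, norm_smul, mul_pow,
    Real.norm_eq_abs, sq_abs, conj_trivial] at ht
  have hsq : t ^ 2 * (1 / 2 * ⟪L v, v⟫) = 1 / 2 * (t * (t * ⟪L v, v⟫)) := by ring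
  rw [hsq, mul_assoc]
  exact ht

/-- The gradient in a second-order expansion of a convex function is a subgradient. -/
lemma HasTaylorTwo.isSubgradient (h : HasTaylorTwo u x g L) (hu : ConvexOn ℝ U u)
    (hx : x ∈ U) : IsSubgradient u U x g := by
  intro z hz
  set v := z - x with hv
  have hlim : Tendsto (fun t : ℝ => u z - u x + t * (‖v‖ ^ 2 - 1 / 2 * ⟪L v, v⟫)) (𝓝[>] 0)
      (𝓝 (u z - u x)) := by
    have : Continuous fun t : ℝ => u z - u x + t * (‖v‖ ^ 2 - 1 / 2 * ⟪L v, v⟫) := by fun_prop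
    simpa using (this.tendsto 0).mono_left nhdsWithin_le_nhds
  have key : ⟪g, v⟫ ≤ u z - u x := by
    refine ge_of_tendsto hlim ?_
    filter_upwards [h.eventually_abs_le_line one_pos v] with t ⟨ht0, ht1, ht⟩
    have hconv := hu.2 hx hz (by linarith : 0 ≤ 1 - t) ht0.le (by ring)
    have hpt : (1 - t) • x + t • z = x + t • v := by rw [hv]; module
    rw [hpt, smul_eq_mul, smul_eq_mul] at hconv
    have := (abs_le.1 ht).1
    refine le_of_mul_le_mul_left ?_ ht0
    nlinarith
  linarith

/-- A positive definite Hessian at `x` makes the subgradient at `x` differ from the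
subgradients at all other points. -/
lemma HasTaylorTwo.eq_of_isSubgradient (h : HasTaylorTwo u x g L) (hu : ConvexOn ℝ U u)
    (hx : x ∈ U) (hy : y ∈ U) (hL : ∀ v ≠ 0, 0 < ⟪L v, v⟫) (hg : IsSubgradient u U y g) :
    x = y := by
  by_contra hne
  set v := y - x with hv
  have hv0 : v ≠ 0 := sub_ne_zero.2 (Ne.symm hne)
  have hpos := hL v hv0
  have hn : 0 < ‖v‖ ^ 2 := by positivity
  obtain ⟨t, ht0, ht1, ht⟩ :=
    (h.eventually_abs_le_line (ε := ⟪L v, v⟫ / (4 * ‖v‖ ^ 2)) (by positivity) v).exists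
  have hconv := hu.2 hx hy (by linarith : 0 ≤ 1 - t) ht0.le (by ring)
  have hpt : (1 - t) • x + t • y = x + t • v := by rw [hv]; module
  rw [hpt, smul_eq_mul, smul_eq_mul] at hconv
  have hsub := hg x hx
  rw [show x - y = -v by rw [hv]; abel, inner_neg_right] at hsub
  have hq : ⟪L v, v⟫ / (4 * ‖v‖ ^ 2) * t ^ 2 * ‖v‖ ^ 2 = t ^ 2 * (⟪L v, v⟫ / 4) := by
    field_simp
  rw [hq] at ht
  have h2 := (abs_le.1 ht).1
  have h3 : 0 < t ^ 2 * ⟪L v, v⟫ := by positivity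
  have h4 := mul_le_mul_of_nonneg_left hsub ht0.le
  nlinarith

/-- A selection of subgradients is differentiable at points of second-order expansion. -/
lemma HasTaylorTwo.hasFDerivWithinAt {G : E → E} {s : Set E} (h : HasTaylorTwo u x (G x) L)
    (hU : U ∈ 𝓝 x) (hL : ∀ v w, ⟪L v, w⟫ = ⟪L w, v⟫)
    (hG : ∀ y ∈ s, IsSubgradient u U y (G y)) : HasFDerivWithinAt G L s x := by
  rw [hasFDerivWithinAt_iff_isLittleO, Asymptotics.isLittleO_iff]
  intro c hc
  set K := ‖L‖ + c + 1 with hK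
  have hKL : 0 ≤ ‖L‖ := norm_nonneg L
  have hKpos : 0 < K := by positivity
  set σ := c / K with hσ
  have hσ0 : 0 < σ := by positivity
  have hσ1 : σ ≤ 1 := by rw [hσ, div_le_one hKpos]; linarith
  have hσK : ‖L‖ * σ ≤ c := by
    rw [hσ, mul_div_assoc', div_le_iff₀ hKpos]; nlinarith
  set ε := c * σ / 10 with hε
  have hε0 : 0 < ε := by positivity
  have hUx : ∀ᶠ v in 𝓝 (0 : E), x + v ∈ U := by
    have : Tendsto (fun v : E => x + v) (𝓝 0) (𝓝 x) := by
      simpa using (continuous_const_add x).tendsto (0 : E)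
    exact this hU
  obtain ⟨r, hr, hball⟩ := Metric.eventually_nhds_iff.1 ((h.eventually_abs_le hε0).and hUx)
  have hnear : ∀ᶠ y in 𝓝[s] x, y ∈ s ∧ ‖y - x‖ < r / 2 := by
    filter_upwards [self_mem_nhdsWithin,
      nhdsWithin_le_nhds (Metric.ball_mem_nhds x (half_pos hr))] with y hy hyb
    exact ⟨hy, by simpa [dist_eq_norm] using hyb⟩
  filter_upwards [hnear] with y ⟨hys, hyr⟩
  set d := y - x with hd
  set q := G y - G x - L d with hq
  rcases eq_or_ne q 0 with hq0 | hq0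
  · rw [hq0, norm_zero]; positivity
  rcases eq_or_ne d 0 with hd0 | hd0
  · have : y = x := sub_eq_zero.1 (hd ▸ hd0)
    exact absurd (by simp [hq, hd0, this]) hq0
  have hdn : 0 < ‖d‖ := norm_pos_iff.2 hd0
  have hqn : 0 < ‖q‖ := norm_pos_iff.2 hq0
  set w := (σ * ‖d‖ / ‖q‖) • q with hw
  have hwn : ‖w‖ = σ * ‖d‖ := by
    rw [hw, norm_smul, Real.norm_of_nonneg (by positivity)]; field_simp
  have hdwn : ‖d + w‖ ≤ 2 * ‖d‖ := by
    have := norm_add_le d w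
    nlinarith
  have hqw : ⟪q, w⟫ = σ * ‖d‖ * ‖q‖ := by
    rw [hw, inner_smul_right, real_inner_self_eq_norm_sq]; field_simp
  have h1 := (hball (y := d) (by rw [dist_zero_right]; linarith)).1
  obtain ⟨h2, h2U⟩ := hball (y := d + w) (by rw [dist_zero_right]; linarith)
  have hyd : x + d = y := by rw [hd]; abel
  have hs := hG y hys _ h2U
  rw [← add_assoc, hyd, add_sub_cancel_left] at hs
  rw [← add_assoc, hyd] at h2
  rw [hyd] at h1
  have hGw : ⟪G y, w⟫ = ⟪q, w⟫ + ⟪G x, w⟫ + ⟪L d, w⟫ := by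
    rw [← inner_add_left, ← inner_add_left, hq]; congr 1; abel
  have hLw : ⟪L w, w⟫ ≤ ‖L‖ * ‖w‖ ^ 2 := by
    calc ⟪L w, w⟫ ≤ ‖L w‖ * ‖w‖ := real_inner_le_norm _ _
      _ ≤ ‖L‖ * ‖w‖ * ‖w‖ := by gcongr; exact L.le_opNorm w
      _ = _ := by ring
  have hexp : ⟪L (d + w), d + w⟫ = ⟪L d, d⟫ + 2 * ⟪L d, w⟫ + ⟪L w, w⟫ := by
    rw [map_add, inner_add_left, inner_add_right, inner_add_right, hL w d]; ring
  rw [hexp, inner_add_right] at h2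
  have h1' := (abs_le.1 h1).1
  have h2' := (abs_le.1 h2).2
  have hsq : ‖d + w‖ ^ 2 ≤ 4 * ‖d‖ ^ 2 := by
    have := pow_le_pow_left₀ (norm_nonneg _) hdwn 2
    linarith [mul_pow 2 ‖d‖ 2]
  have hsq' := mul_le_mul_of_nonneg_left hsq hε0.le
  rw [hwn] at hLw
  have hmain : σ * ‖d‖ * ‖q‖ ≤ 1 / 2 * (‖L‖ * (σ * ‖d‖) ^ 2) + 5 * ε * ‖d‖ ^ 2 := by
    rw [← hqw]; linarith
  have hLσ : ‖L‖ * (σ * ‖d‖) ^ 2 ≤ c * σ * ‖d‖ ^ 2 := by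
    calc ‖L‖ * (σ * ‖d‖) ^ 2 = (‖L‖ * σ) * (σ * ‖d‖ ^ 2) := by ring
      _ ≤ c * (σ * ‖d‖ ^ 2) := by gcongr
      _ = _ := by ring
  refine le_of_mul_le_mul_left ?_ (mul_pos hσ0 hdn)
  rw [hε] at hmain
  nlinarith

/-- A subgradient at the centre of a ball of radius `δ` on which `u` oscillates by at most
`M` has norm at most `M / δ`. -/
lemma IsSubgradient.norm_le {δ M : ℝ} (hp : IsSubgradient u U x p) (hδ : 0 < δ)
    (hball : ball x δ ⊆ U) (hM : ∀ z ∈ U, u z - u x ≤ M) : ‖p‖ ≤ M / δ := by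
  have hxU : x ∈ U := hball (mem_ball_self hδ)
  have hM0 : 0 ≤ M := by simpa using hM x hxU
  rcases eq_or_ne p 0 with hp0 | hp0
  · rw [hp0, norm_zero]; positivity
  have hpn : 0 < ‖p‖ := norm_pos_iff.2 hp0
  rw [le_div_iff₀ hδ, mul_comm, ← le_div_iff₀ hpn]
  refine le_of_forall_lt_imp_le_of_dense fun r hr => ?_
  rcases le_or_gt r 0 with hr0 | hr0
  · exact hr0.trans (by positivity)
  have hz : x + (r / ‖p‖) • p ∈ U := by
    refine hball ?_
    rw [mem_ball, dist_eq_norm, add_sub_cancel_left, norm_smul,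
      Real.norm_of_nonneg (by positivity), div_mul_cancel₀ _ hpn.ne']
    exact hr
  have h1 := hp _ hz
  have h2 := hM _ hz
  rw [add_sub_cancel_left, inner_smul_right, real_inner_self_eq_norm_sq] at h1
  rw [le_div_iff₀ hpn]
  have : r / ‖p‖ * ‖p‖ ^ 2 = r * ‖p‖ := by field_simp
  linarith

lemma ball_subset_of_le_infDist_frontier {δ : ℝ} (hU : IsOpen U) (hx : x ∈ U) (hδ : 0 < δ)
    (h : δ ≤ infDist x (frontier U)) : ball x δ ⊆ U := by
  refine (convex_ball x δ).isPreconnected.subset_left_of_subset_union hU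
    isClosed_closure.isOpen_compl (disjoint_compl_right.mono_left subset_closure) ?_
    ⟨x, mem_ball_self hδ, hx⟩
  intro y hy
  have hyf : y ∉ frontier U := ball_infDist_subset_compl (ball_subset_ball h hy)
  rw [hU.frontier_eq] at hyf
  by_contra hcon
  simp only [mem_union, mem_compl_iff, not_or, not_not] at hcon
  exact hyf ⟨hcon.2, hcon.1⟩

end Taylor

lemma inner_toEuclideanCLM {n : ℕ} (A : Matrix (Fin n) (Fin n) ℝ)
    (v w : EuclideanSpace ℝ (Fin n)) :
    ⟪Matrix.toEuclideanCLM (𝕜 := ℝ) A v, w⟫ = ∑ i, ∑ j, A i j * w i * v j := by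
  simp [PiLp.inner_apply, Matrix.mulVec, dotProduct, Finset.mul_sum, mul_assoc, mul_left_comm, mul_comm]

lemma det_toEuclideanCLM {n : ℕ} (A : Matrix (Fin n) (Fin n) ℝ) :
    (Matrix.toEuclideanCLM (𝕜 := ℝ) A).det = A.det := by
  rw [ContinuousLinearMap.det, Matrix.coe_toEuclideanCLM_eq_toEuclideanLin]
  simp

lemma inner_toEuclideanCLM_comm {n : ℕ} {A : Matrix (Fin n) (Fin n) ℝ} (hA : A.IsHermitian)
    (v w : EuclideanSpace ℝ (Fin n)) :
    ⟪Matrix.toEuclideanCLM (𝕜 := ℝ) A v, w⟫ = ⟪Matrix.toEuclideanCLM (𝕜 := ℝ) A w, v⟫ := by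
  rw [inner_toEuclideanCLM, inner_toEuclideanCLM, Finset.sum_comm]
  refine Finset.sum_congr rfl fun i _ => Finset.sum_congr rfl fun j _ => ?_
  have := hA.apply i j
  rw [star_trivial] at this
  rw [this]; ring

lemma inner_toEuclideanCLM_pos {n : ℕ} {A : Matrix (Fin n) (Fin n) ℝ} (hA : A.PosSemidef)
    (hdet : A.det ≠ 0) {v : EuclideanSpace ℝ (Fin n)} (hv : v ≠ 0) :
    0 < ⟪Matrix.toEuclideanCLM (𝕜 := ℝ) A v, v⟫ := by
  have hpd : A.PosDef :=
    hA.posDef_iff_isUnit.2 ((Matrix.isUnit_iff_isUnit_det A).2 hdet.isUnit)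
  have hv' : v.ofLp ≠ 0 := fun h => hv (by ext i; simp [h])
  have := hpd.dotProduct_mulVec_pos hv'
  rw [real_inner_comm]
  simpa [EuclideanSpace.inner_eq_star_dotProduct, dotProduct_comm] using this

lemma hasTaylorTwo_of_tendsto {n : ℕ} {u : EuclideanSpace ℝ (Fin n) → ℝ}
    {A : Matrix (Fin n) (Fin n) ℝ} {x g : EuclideanSpace ℝ (Fin n)}
    (h : Tendsto (fun y : EuclideanSpace ℝ (Fin n) =>
          (u y - u x - ⟪g, y - x⟫
            - (1 / 2) * ∑ i : Fin n, ∑ j : Fin n, A i j * (y - x) i * (y - x) j)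
          / ‖y - x‖ ^ 2)
        (𝓝[≠] x) (𝓝 0)) :
    HasTaylorTwo u x g (Matrix.toEuclideanCLM (𝕜 := ℝ) A) := by
  rw [HasTaylorTwo, Asymptotics.isLittleO_iff]
  intro ε hε
  have hev : ∀ᶠ y in 𝓝 x, y ≠ x → _ := eventually_nhdsWithin_iff.1
    (h.eventually (Metric.closedBall_mem_nhds (0 : ℝ) hε))
  have hshift : Tendsto (fun v : EuclideanSpace ℝ (Fin n) => x + v) (𝓝 0) (𝓝 x) := by
    simpa using (continuous_const_add x).tendsto (0 : EuclideanSpace ℝ (Fin n))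
  filter_upwards [hshift.eventually hev] with v hv
  rcases eq_or_ne v 0 with rfl | hv0
  · simp
  have hv1 := hv (by simpa using hv0)
  rw [dist_zero_right, add_sub_cancel_left, norm_div,
    div_le_iff₀ (norm_pos_iff.2 (pow_ne_zero 2 (norm_ne_zero_iff.2 hv0)))] at hv1
  rwa [inner_toEuclideanCLM]

/-- the Alexandrov–Monge–Ampère bound
`∫_Ω det H ≤ ω_n (osc_U u / δ)ⁿ` for a convex function on a bounded open convex set and a
subset at distance `≥ δ` from the boundary. -/
theorem det_hessian_integral_bound
    (n : ℕ) (hn : 1 ≤ n) (U : Set (EuclideanSpace ℝ (Fin n)))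
    (hUo : IsOpen U) (hUc : Convex ℝ U) (hUb : Bornology.IsBounded U) (hUne : U.Nonempty)
    (u : EuclideanSpace ℝ (Fin n) → ℝ) (hu : ConvexOn ℝ U u)
    (hbddA : BddAbove (u '' U)) (hbddB : BddBelow (u '' U))
    (H : EuclideanSpace ℝ (Fin n) → Matrix (Fin n) (Fin n) ℝ)
    (hH : IsAlexHessian U u H)
    (δ : ℝ) (hδ : 0 < δ) (Ω : Set (EuclideanSpace ℝ (Fin n)))
    (hΩm : MeasurableSet Ω) (hΩU : Ω ⊆ U)
    (hdist : ∀ x ∈ Ω, δ ≤ Metric.infDist x (frontier U)) :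
    ∫⁻ x in Ω, ENNReal.ofReal (H x).det ≤
      ENNReal.ofReal ((volume (Metric.ball (0 : EuclideanSpace ℝ (Fin n)) 1)).toReal *
        ((sSup (u '' U) - sInf (u '' U)) / δ) ^ n) := by
  classical
  obtain ⟨hHm, hHae⟩ := hH
  have hdetm : Measurable fun x => (H x).det := by
    simp only [Matrix.det_apply]
    fun_prop
  obtain ⟨N, hNsub, hNm, hN0⟩ := exists_measurable_superset_of_null (ae_iff.1 hHae)
  have hgood : ∀ x, x ∉ N → (H x).PosSemidef ∧ ∃ g : EuclideanSpace ℝ (Fin n),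
      HasTaylorTwo u x g (Matrix.toEuclideanCLM (𝕜 := ℝ) (H x)) := by
    intro x hx
    obtain ⟨h1, g, hg⟩ := not_not.1 fun h => hx (hNsub h)
    exact ⟨h1, g, hasTaylorTwo_of_tendsto hg⟩
  choose! hpsd G hG using hgood
  set M := sSup (u '' U) - sInf (u '' U) with hM
  set S := (Ω \ N) ∩ {x | 0 < (H x).det} with hS
  have hSm : MeasurableSet S :=
    (hΩm.diff hNm).inter (measurableSet_lt measurable_const hdetm)
  have hSU : ∀ x ∈ S, x ∈ U := fun x hx => hΩU hx.1.1
  have hsub : ∀ x ∈ S, IsSubgradient u U x (G x) := fun x hx =>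
    (hG x hx.1.2).isSubgradient hu (hSU x hx)
  have hderiv : ∀ x ∈ S,
      HasFDerivWithinAt G (Matrix.toEuclideanCLM (𝕜 := ℝ) (H x)) S x := fun x hx =>
    (hG x hx.1.2).hasFDerivWithinAt (hUo.mem_nhds (hSU x hx))
      (inner_toEuclideanCLM_comm (hpsd x hx.1.2).1) hsub
  have hinj : InjOn G S := fun x hx y hy hxy =>
    (hG x hx.1.2).eq_of_isSubgradient hu (hSU x hx) (hSU y hy)
      (fun _ hv => inner_toEuclideanCLM_pos (hpsd x hx.1.2) (ne_of_gt hx.2) hv)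
      (hxy ▸ hsub y hy)
  have hMle : ∀ x ∈ U, ∀ z ∈ U, u z - u x ≤ M := fun x hx z hz =>
    sub_le_sub (le_csSup hbddA (mem_image_of_mem u hz)) (csInf_le hbddB (mem_image_of_mem u hx))
  have hM0 : 0 ≤ M := by
    obtain ⟨x, hx⟩ := hUne
    simpa using hMle x hx x hx
  have himage : G '' S ⊆ closedBall 0 (M / δ) := by
    rintro _ ⟨x, hx, rfl⟩
    rw [mem_closedBall_zero_iff]
    exact (hsub x hx).norm_le hδ
      (ball_subset_of_le_infDist_frontier hUo (hSU x hx) hδ (hdist x hx.1.1)) (hMle x (hSU x hx))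
  have hNΩ : ∀ᵐ x ∂volume.restrict Ω, x ∉ N :=
    (Measure.restrict_mono_set volume hΩU).absolutelyContinuous.ae_le
      (measure_eq_zero_iff_ae_notMem.1 hN0)
  calc ∫⁻ x in Ω, ENNReal.ofReal (H x).det
      = ∫⁻ x in Ω, S.indicator (fun x => ENNReal.ofReal (H x).det) x := by
        refine lintegral_congr_ae ?_
        filter_upwards [hNΩ, ae_restrict_mem hΩm] with x hxN hxΩ
        by_cases hxS : x ∈ S
        · rw [indicator_of_mem hxS]
        · rw [indicator_of_notMem hxS, ENNReal.ofReal_eq_zero]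
          exact not_lt.1 fun h => hxS ⟨⟨hxΩ, hxN⟩, h⟩
    _ ≤ ∫⁻ x, S.indicator (fun x => ENNReal.ofReal (H x).det) x :=
        setLIntegral_le_lintegral _ _
    _ = ∫⁻ x in S, ENNReal.ofReal |(Matrix.toEuclideanCLM (𝕜 := ℝ) (H x)).det| := by
        rw [lintegral_indicator hSm]
        refine setLIntegral_congr_fun hSm fun x hx => ?_
        simp only [det_toEuclideanCLM]
        rw [abs_of_pos hx.2]
    _ = volume (G '' S) := lintegral_abs_det_fderiv_eq_addHaar_image volume hSm hderiv hinj
    _ ≤ volume (closedBall (0 : EuclideanSpace ℝ (Fin n)) (M / δ)) := measure_mono himage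
    _ = _ := by
        rw [Measure.addHaar_closedBall volume _ (by positivity), finrank_euclideanSpace_fin,
          ENNReal.ofReal_mul ENNReal.toReal_nonneg, ENNReal.ofReal_toReal measure_ball_lt_top.ne,
          mul_comm]

end ToricExtremal
end
end
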